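/- arXiv:1611.01992 — 12 statements merged into one kernel-verified Lean document; each statement's English description precedes it below -/
import Mathlib

section
/- Let A be a finite-dimensional (not necessarily unital or associative) algebra over a field K equipped with a symmetric, invariant, nondegenerate bilinear form, let R : A → A be a K-linear map and R* : A → A its adjoint with respect to the form. Then the following three conditions are equivalent: (i) R(x)·R(y) = R(R(x)·y) for all x,y ∈ A; (ii) R*(x)·R(y) = R*(x·R(y)) for all x,y ∈ A; (iii) R*(R(x)·y) = R*(x·R*(y)) for all x,y ∈ A. -/
/-- Lemma 2 (first triple): for a finite-dimensional algebra `A` (not necessarily unital or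
associative) with a symmetric invariant nondegenerate bilinear form, and a linear map `R`
with adjoint `Rs`, the identities (i) `R x * R y = R (R x * y)`,
(ii) `Rs x * R y = Rs (x * R y)`, (iii) `Rs (R x * y) = Rs (x * Rs y)` are equivalent. -/
theorem stmt0 {K A : Type*} [Field K] [AddCommGroup A] [Module K A]
    [FiniteDimensional K A]
    (mul : A →ₗ[K] A →ₗ[K] A)
    (B : A →ₗ[K] A →ₗ[K] K)
    (hsym : ∀ x y, B x y = B y x)
    (hinv : ∀ x y z, B (mul x y) z = B x (mul y z))
    (hnd : ∀ x, (∀ y, B x y = 0) → x = 0)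
    (R Rs : A →ₗ[K] A)
    (hadj : ∀ x y, B (Rs x) y = B x (R y)) :
    ((∀ x y, mul (R x) (R y) = R (mul (R x) y)) ↔
      (∀ x y, mul (Rs x) (R y) = Rs (mul x (R y)))) ∧
    ((∀ x y, mul (R x) (R y) = R (mul (R x) y)) ↔
      (∀ x y, Rs (mul (R x) y) = Rs (mul x (Rs y)))) := by
  have ext_form : ∀ {u v : A}, (∀ y, B u y = B v y) → u = v := fun h ↦
    sub_eq_zero.mp (hnd _ fun y ↦ by rw [map_sub, LinearMap.sub_apply, h, sub_self])
  have pair_left_ii : ∀ x y z, B (mul (Rs z) (R x)) y = B (R (mul (R x) y)) z := fun x y z ↦ by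
    rw [hinv, hadj, hsym]
  have pair_right_ii : ∀ x y z, B (Rs (mul z (R x))) y = B (mul (R x) (R y)) z := fun x y z ↦ by
    rw [hadj, hinv, hsym]
  have pair_left_iii : ∀ x y z, B (Rs (mul (R y) z)) x = B (mul (R x) (R y)) z := fun x y z ↦ by
    rw [hadj, hsym, hinv]
  have pair_right_iii : ∀ x y z, B (Rs (mul y (Rs z))) x = B (R (mul (R x) y)) z := fun x y z ↦ by
    rw [hadj, hsym, ← hinv, hsym, hadj, hsym]
  refine ⟨⟨fun h z x ↦ ext_form fun y ↦ ?_, fun h x y ↦ ext_form fun z ↦ ?_⟩,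
    ⟨fun h y z ↦ ext_form fun x ↦ ?_, fun h x y ↦ ext_form fun z ↦ ?_⟩⟩
  · rw [pair_left_ii, pair_right_ii, h]
  · rw [← pair_left_ii, ← pair_right_ii, h]
  · rw [pair_left_iii, pair_right_iii, h]
  · rw [← pair_left_iii, ← pair_right_iii, h]
end

section
/- Let A be a finite-dimensional (not necessarily unital or associative) algebra over a field K equipped with a symmetric, invariant, nondegenerate bilinear form, let R : A → A be a K-linear map and R* : A → A its adjoint with respect to the form. Then the following three conditions are equivalent: (i) R*(x)·R*(y) = R*(R*(x)·y) for all x,y ∈ A; (ii) R(x)·R*(y) = R(x·R*(y)) for all x,y ∈ A; (iii) R(R*(x)·y) = R(x·R(y)) for all x,y ∈ A. -/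
/-- Lemma 2 (second triple): for a finite-dimensional algebra `A` (not necessarily unital or
associative) with a symmetric invariant nondegenerate bilinear form, and a linear map `R`
with adjoint `Rs`, the identities (i) `Rs x * Rs y = Rs (Rs x * y)`,
(ii) `R x * Rs y = R (x * Rs y)`, (iii) `R (Rs x * y) = R (x * R y)` are equivalent. -/
theorem stmt1 {K A : Type*} [Field K] [AddCommGroup A] [Module K A]
    [FiniteDimensional K A]
    (mul : A →ₗ[K] A →ₗ[K] A)
    (B : A →ₗ[K] A →ₗ[K] K)
    (hsym : ∀ x y, B x y = B y x)
    (hinv : ∀ x y z, B (mul x y) z = B x (mul y z))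
    (hnd : ∀ x, (∀ y, B x y = 0) → x = 0)
    (R Rs : A →ₗ[K] A)
    (hadj : ∀ x y, B (Rs x) y = B x (R y)) :
    ((∀ x y, mul (Rs x) (Rs y) = Rs (mul (Rs x) y)) ↔
      (∀ x y, mul (R x) (Rs y) = R (mul x (Rs y)))) ∧
    ((∀ x y, mul (Rs x) (Rs y) = Rs (mul (Rs x) y)) ↔
      (∀ x y, R (mul (Rs x) y) = R (mul x (R y)))) := by
  have hcyc : ∀ x y z, B (mul x y) z = B y (mul z x) := fun x y z => by
    rw [hinv, hsym, hinv]
  have hext : ∀ u v, (∀ z, B u z = B v z) → u = v := fun u v h =>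
    sub_eq_zero.mp (hnd _ fun z => by rw [map_sub, LinearMap.sub_apply, h z, sub_self])
  have hext' : ∀ u v, (∀ z, B z u = B z v) → u = v := fun u v h =>
    hext u v fun z => by rw [hsym u, hsym v, h z]
  have h₂l : ∀ x y z, B (mul (Rs x) (Rs y)) z = B y (R (mul z (Rs x))) := fun x y z => by
    rw [hcyc, hadj]
  have h₂r : ∀ x y z, B (Rs (mul (Rs x) y)) z = B y (mul (R z) (Rs x)) := fun x y z => by
    rw [hadj, hcyc]
  have h₃l : ∀ x y z, B (mul (Rs x) (Rs y)) z = B x (R (mul (Rs y) z)) := fun x y z => by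
    rw [hinv, hadj]
  have h₃r : ∀ x y z, B (Rs (mul (Rs x) y)) z = B x (R (mul y (R z))) := fun x y z => by
    rw [hadj, hinv, hadj]
  refine ⟨⟨fun h x y => hext' _ _ fun z => ?_, fun h x y => hext _ _ fun z => ?_⟩,
    ⟨fun h x y => hext' _ _ fun z => ?_, fun h x y => hext _ _ fun z => ?_⟩⟩
  · rw [← h₂r, ← h₂l, h]
  · rw [h₂l, h₂r, h]
  · rw [← h₃l, ← h₃r, h]
  · rw [h₃l, h₃r, h]
end

section
/- Let A be a finite-dimensional (not necessarily unital or associative) algebra over a field K equipped with a symmetric, invariant, nondegenerate bilinear form, let T : A → A be a K-linear map and T* : A → A its adjoint with respect to the form. Suppose T is left averaging (T(x)·T(y) = T(T(x)·y) for all x,y ∈ A) and T* is left averaging (T*(x)·T*(y) = T*(T*(x)·y) for all x,y ∈ A). Then R = T − T* is a skew-symmetric Rota–Baxter operator on A; that is, ⟨R(x),y⟩ = −⟨x,R(y)⟩ for all x,y ∈ A, and R(x)·R(y) = R(R(x)·y) + R(x·R(y)) for all x,y ∈ A. -/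
section LeftAveraging

variable {K A : Type*} [Field K] [AddCommGroup A] [Module K A]
  {mul : A →ₗ[K] A →ₗ[K] A} {B : A →ₗ[K] A →ₗ[K] K}

/-- If `T` is left averaging, then its adjoint satisfies `T*(z · T x) = T* z · T x`. -/
theorem adjoint_mul_apply_of_left_averaging
    (hinv : ∀ x y z, B (mul x y) z = B x (mul y z))
    (hnd : ∀ x, (∀ y, B x y = 0) → x = 0)
    {T Ts : A →ₗ[K] A} (hadj : ∀ x y, B (Ts x) y = B x (T y))
    (hT : ∀ x y, mul (T x) (T y) = T (mul (T x) y)) (z x : A) :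
    Ts (mul z (T x)) = mul (Ts z) (T x) := by
  refine sub_eq_zero.mp (hnd _ fun y => ?_)
  rw [map_sub, LinearMap.sub_apply, sub_eq_zero]
  rw [hadj, hinv, hT, ← hadj, ← hinv]

/-- If `T` is left averaging, then its adjoint satisfies `T*(T y · z) = T*(y · T* z)`. -/
theorem adjoint_apply_mul_of_left_averaging
    (hsym : ∀ x y, B x y = B y x)
    (hinv : ∀ x y z, B (mul x y) z = B x (mul y z))
    (hnd : ∀ x, (∀ y, B x y = 0) → x = 0)
    {T Ts : A →ₗ[K] A} (hadj : ∀ x y, B (Ts x) y = B x (T y))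
    (hT : ∀ x y, mul (T x) (T y) = T (mul (T x) y)) (y z : A) :
    Ts (mul (T y) z) = Ts (mul y (Ts z)) := by
  refine sub_eq_zero.mp (hnd _ fun x => ?_)
  rw [map_sub, LinearMap.sub_apply, sub_eq_zero]
  rw [hadj, hadj, hsym, ← hinv, hT, hsym, ← hadj, hsym, hinv, hsym]

end LeftAveraging

/-- Corollary: if `T` is a left averaging operator on a finite-dimensional algebra `A`
(not necessarily unital or associative) with a symmetric invariant nondegenerate bilinear
form, and the adjoint `Ts` of `T` is also left averaging, then `R = T - Ts` is a
skew-symmetric Rota–Baxter operator on `A`. -/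
theorem stmt2 {K A : Type*} [Field K] [AddCommGroup A] [Module K A]
    [FiniteDimensional K A]
    (mul : A →ₗ[K] A →ₗ[K] A)
    (B : A →ₗ[K] A →ₗ[K] K)
    (hsym : ∀ x y, B x y = B y x)
    (hinv : ∀ x y z, B (mul x y) z = B x (mul y z))
    (hnd : ∀ x, (∀ y, B x y = 0) → x = 0)
    (T Ts : A →ₗ[K] A)
    (hadj : ∀ x y, B (Ts x) y = B x (T y))
    (hT : ∀ x y, mul (T x) (T y) = T (mul (T x) y))
    (hTs : ∀ x y, mul (Ts x) (Ts y) = Ts (mul (Ts x) y)) :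
    (∀ x y, B ((T - Ts) x) y = - B x ((T - Ts) y)) ∧
    (∀ x y, mul ((T - Ts) x) ((T - Ts) y) =
      (T - Ts) (mul ((T - Ts) x) y) + (T - Ts) (mul x ((T - Ts) y))) := by
  have hadj' : ∀ x y, B (T x) y = B x (Ts y) := fun x y => by
    rw [hsym, ← hadj, hsym]
  refine ⟨fun x y => ?_, fun x y => ?_⟩
  · simp [hadj, hadj']
  · have h₁ := adjoint_mul_apply_of_left_averaging hinv hnd hadj hT x y
    have h₂ := adjoint_mul_apply_of_left_averaging hinv hnd hadj' hTs x y
    have h₃ := adjoint_apply_mul_of_left_averaging hsym hinv hnd hadj hT x y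
    have h₄ := adjoint_apply_mul_of_left_averaging hsym hinv hnd hadj' hTs x y
    simp only [LinearMap.sub_apply, map_sub, hT, hTs, h₁, h₂, h₃, h₄]
    abel
end

section
/- Let K be a field and V a finite-dimensional K-vector space with finrank K V > 1, and let D : V ⊗[K] V → V ⊗[K] V be a double bracket satisfying the double Lie identities. Then there exists an ideal I of the double algebra (V, D) with I ≠ 0 and I ≠ V. -/
open TensorProduct

section DoubleDefs

variable (K : Type*) [Field K] (X : Type*) [AddCommGroup X] [Module K X]

/-- The flip `v ⊗ w ↦ w ⊗ v` on `X ⊗ X`. -/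
noncomputable def flipT : X ⊗[K] X →ₗ[K] X ⊗[K] X := (TensorProduct.comm K X X).toLinearMap

/-- The permutation `τ₁₂ = τ ⊗ id` on `(X ⊗ X) ⊗ X`. -/
noncomputable def t12 : (X ⊗[K] X) ⊗[K] X →ₗ[K] (X ⊗[K] X) ⊗[K] X :=
  TensorProduct.map (flipT K X) LinearMap.id

/-- The permutation `τ₂₃ = id ⊗ τ` on `(X ⊗ X) ⊗ X` (via the canonical associator). -/
noncomputable def t23 : (X ⊗[K] X) ⊗[K] X →ₗ[K] (X ⊗[K] X) ⊗[K] X :=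
  (TensorProduct.assoc K X X X).symm.toLinearMap ∘ₗ
    TensorProduct.map LinearMap.id (flipT K X) ∘ₗ (TensorProduct.assoc K X X X).toLinearMap

variable {K X}

/-- `D ⊗ id` on `(X ⊗ X) ⊗ X`. -/
noncomputable def dL (D : X ⊗[K] X →ₗ[K] X ⊗[K] X) :
    (X ⊗[K] X) ⊗[K] X →ₗ[K] (X ⊗[K] X) ⊗[K] X := TensorProduct.map D LinearMap.id

/-- `id ⊗ D` on `(X ⊗ X) ⊗ X` (via the canonical associator). -/
noncomputable def dR (D : X ⊗[K] X →ₗ[K] X ⊗[K] X) :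
    (X ⊗[K] X) ⊗[K] X →ₗ[K] (X ⊗[K] X) ⊗[K] X :=
  (TensorProduct.assoc K X X X).symm.toLinearMap ∘ₗ
    TensorProduct.map LinearMap.id D ∘ₗ (TensorProduct.assoc K X X X).toLinearMap

/-- `D` satisfies the double Lie identities: anti-symmetry and the double Jacobi identity. -/
def IsDoubleLie (D : X ⊗[K] X →ₗ[K] X ⊗[K] X) : Prop :=
  flipT K X ∘ₗ D ∘ₗ flipT K X = -D ∧
  dL D ∘ₗ dR D - dR D ∘ₗ t12 K X ∘ₗ dR D ∘ₗ t12 K X =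
    t23 K X ∘ₗ dL D ∘ₗ t23 K X ∘ₗ dL D

/-- `D` satisfies the double associativity identities. -/
def IsDoubleAssoc (D : X ⊗[K] X →ₗ[K] X ⊗[K] X) : Prop :=
  dL D ∘ₗ dR D = t23 K X ∘ₗ dL D ∘ₗ t23 K X ∘ₗ dL D ∧
  t12 K X ∘ₗ dR D ∘ₗ t12 K X ∘ₗ dR D = dR D ∘ₗ dL D

/-- The image of `I ⊗ X` in `X ⊗ X`. -/
noncomputable def sideL (I : Submodule K X) : Submodule K (X ⊗[K] X) :=
  LinearMap.range (TensorProduct.map I.subtype (LinearMap.id : X →ₗ[K] X))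

/-- The image of `X ⊗ I` in `X ⊗ X`. -/
noncomputable def sideR (I : Submodule K X) : Submodule K (X ⊗[K] X) :=
  LinearMap.range (TensorProduct.map (LinearMap.id : X →ₗ[K] X) I.subtype)

/-- `I` is an ideal of the double algebra `(X, D)`:
`D` maps `I⊗X + X⊗I` into `I⊗X + X⊗I`. -/
def IsDoubleIdeal (D : X ⊗[K] X →ₗ[K] X ⊗[K] X) (I : Submodule K X) : Prop :=
  Submodule.map D (sideL I ⊔ sideR I) ≤ sideL I ⊔ sideR I

/-- The double algebra `(X, D)` is simple. -/
def IsSimpleDouble (D : X ⊗[K] X →ₗ[K] X ⊗[K] X) : Prop :=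
  D ≠ 0 ∧ ∀ I : Submodule K X, IsDoubleIdeal D I → I = ⊥ ∨ I = ⊤

end DoubleDefs

open Module

/-- A nonzero algebra of endomorphisms acting irreducibly on a finite-dimensional space, not assumed
unital, contains the identity. -/
theorem one_mem_of_irreducible {K V : Type*} [Field K] [AddCommGroup V] [Module K V]
    [FiniteDimensional K V] (B : Submodule K (End K V))
    (hmul : ∀ a ∈ B, ∀ b ∈ B, a * b ∈ B) (hB : B ≠ ⊥)
    (hirr : ∀ I : Submodule K V, (∀ b ∈ B, ∀ u ∈ I, b u ∈ I) → I = ⊥ ∨ I = ⊤) :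
    (1 : End K V) ∈ B := by
  obtain ⟨b₀, hb₀, hb₀0⟩ := B.ne_bot_iff.mp hB
  have : Nontrivial V := by
    by_contra h
    rw [not_nontrivial_iff_subsingleton] at h
    exact hb₀0 (Subsingleton.elim _ _)
  let S : Subalgebra K (End K V) := Algebra.adjoin K (B : Set (End K V))
  have hideal : ∀ a ∈ S, ∀ b ∈ B, a * b ∈ B ∧ b * a ∈ B := by
    intro a ha
    induction ha using Algebra.adjoin_induction with
    | mem x hx => exact fun b hb => ⟨hmul _ hx _ hb, hmul _ hb _ hx⟩
    | algebraMap r =>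
      intro b hb
      rw [← Algebra.commutes r b, ← Algebra.smul_def]
      exact ⟨B.smul_mem r hb, B.smul_mem r hb⟩
    | add x y _ _ hx hy =>
      intro b hb
      rw [add_mul, mul_add]
      exact ⟨B.add_mem (hx b hb).1 (hy b hb).1, B.add_mem (hx b hb).2 (hy b hb).2⟩
    | mul x y _ _ hx hy =>
      intro b hb
      rw [mul_assoc, ← mul_assoc b]
      exact ⟨(hx _ (hy b hb).1).1, (hy _ (hx b hb).2).2⟩
  have : IsSimpleModule S V := by
    rw [isSimpleModule_iff]
    refine ⟨fun I => ?_⟩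
    have h := hirr (I.restrictScalars K) fun b hb u hu =>
      I.smul_mem (⟨b, Algebra.subset_adjoin hb⟩ : S) hu
    simpa using h
  let v := finBasis K V
  let φ : S →ₗ[S] (Fin (finrank K V) → V) :=
    LinearMap.pi fun i => LinearMap.toSpanSingleton S V (v i)
  have hφ : Function.Injective φ := by
    intro a b hab
    exact Subtype.ext (v.ext fun i => congrFun hab i)
  have : IsSemisimpleModule S S := IsSemisimpleModule.of_injective φ hφ
  let J : Submodule S S :=
    { carrier := {a | (a : End K V) ∈ B}
      add_mem' := fun ha hb => B.add_mem ha hb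
      zero_mem' := B.zero_mem
      smul_mem' := fun c a ha => (hideal c c.2 a ha).1 }
  obtain ⟨C, hC⟩ := exists_isCompl J
  obtain ⟨e, he, c, hc, hec⟩ := Submodule.mem_sup.mp
    (hC.sup_eq_top ▸ Submodule.mem_top : (1 : S) ∈ J ⊔ C)
  have hann : ∀ b ∈ B, b * (c : End K V) = 0 := by
    intro b hb
    let b' : S := ⟨b, Algebra.subset_adjoin hb⟩
    have h₁ : b' * c ∈ J := (hideal c c.2 b hb).2
    have h₂ : b' * c ∈ C := C.smul_mem b' hc
    exact congrArg Subtype.val (Submodule.disjoint_def.mp hC.disjoint _ h₁ h₂)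
  have hker : (⨅ b ∈ B, LinearMap.ker b : Submodule K V) = ⊥ := by
    refine (hirr _ fun b hb u hu => ?_).resolve_right fun h => hb₀0 ?_
    · simp only [Submodule.mem_iInf, LinearMap.mem_ker] at hu ⊢
      intro b' hb'
      rw [hu b hb, map_zero]
    · exact LinearMap.ker_eq_top.mp (top_le_iff.mp (h ▸ iInf₂_le b₀ hb₀))
  have hc0 : c = 0 := by
    refine Subtype.ext (LinearMap.ext fun u => ?_)
    have hu : (c : End K V) u ∈ (⨅ b ∈ B, LinearMap.ker b : Submodule K V) := by
      simp only [Submodule.mem_iInf, LinearMap.mem_ker]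
      exact fun b hb => LinearMap.congr_fun (hann b hb) u
    rw [hker] at hu
    simpa using hu
  rw [hc0, add_zero] at hec
  rw [hec] at he
  exact he

/-- Contraction of the first factor of an endomorphism of `M ⊗ N` against a functional. -/
noncomputable def contractFst {K M : Type*} (N : Type*) [Field K] [AddCommGroup M] [Module K M]
    [FiniteDimensional K M] [AddCommGroup N] [Module K N] [FiniteDimensional K N]
    (α : Dual K (End K M)) : End K (M ⊗[K] N) →ₗ[K] End K N :=
  (TensorProduct.lid K (End K N)).toLinearMap ∘ₗ TensorProduct.map α LinearMap.id ∘ₗ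
    (homTensorHomEquiv K M N M N).symm.toLinearMap

theorem contractFst_map {K M N : Type*} [Field K] [AddCommGroup M] [Module K M]
    [FiniteDimensional K M] [AddCommGroup N] [Module K N] [FiniteDimensional K N]
    (α : Dual K (End K M)) (f : End K M) (g : End K N) :
    contractFst N α (TensorProduct.map f g) = α f • g := by
  have h : (homTensorHomEquiv K M N M N).symm (TensorProduct.map f g) = f ⊗ₜ g := by
    rw [LinearEquiv.symm_apply_eq]
    simp
  simp [contractFst, h]

section DoubleLie

variable {K V ι : Type*} [Field K] [AddCommGroup V] [Module K V] [Fintype ι]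
  {D : V ⊗[K] V →ₗ[K] V ⊗[K] V}

theorem exists_eq_sum_map_basis [FiniteDimensional K V] (e : Basis ι K (End K V))
    (D : V ⊗[K] V →ₗ[K] V ⊗[K] V) :
    ∃ g : ι → End K V, D = ∑ i, TensorProduct.map (e i) (g i) := by
  obtain ⟨c, hc⟩ :=
    TensorProduct.eq_repr_basis_left e ((homTensorHomEquiv K V V V V).symm D)
  refine ⟨c, ?_⟩
  rw [LinearEquiv.eq_symm_apply, Finsupp.sum_fintype _ _ (by simp)] at hc
  simpa using hc.symm

variable {f g : ι → End K V}

theorem IsDoubleLie.sum_smul_swap [FiniteDimensional K V] (hD : IsDoubleLie D)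
    (hfg : D = ∑ i, TensorProduct.map (f i) (g i)) (α : Dual K (End K V)) :
    ∑ i, α (g i) • f i = -∑ i, α (f i) • g i := by
  have hswap : ∑ i, TensorProduct.map (g i) (f i) = -∑ i, TensorProduct.map (f i) (g i) := by
    rw [← hfg, ← hD.1, hfg]
    ext x y
    simp [flipT]
  simpa [contractFst_map] using congrArg (contractFst V α) hswap

theorem IsDoubleLie.sum_map_mul (hD : IsDoubleLie D)
    (hfg : D = ∑ i, TensorProduct.map (f i) (g i)) :
    ∑ i, ∑ j, TensorProduct.map (TensorProduct.map (f i) (g i * f j)) (g j) =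
      ∑ i, ∑ j, TensorProduct.map (TensorProduct.map (f j) (f i)) (g i * g j) +
        ∑ i, ∑ j, TensorProduct.map (TensorProduct.map (f i * f j) (g j)) (g i) := by
  have h : dL D ∘ₗ dR D =
      dR D ∘ₗ t12 K V ∘ₗ dR D ∘ₗ t12 K V + t23 K V ∘ₗ dL D ∘ₗ t23 K V ∘ₗ dL D := by
    rw [← hD.2]
    exact LinearMap.ext fun t => (add_sub_cancel _ _).symm
  have hD' (x y : V) : D (x ⊗ₜ y) = ∑ i, f i x ⊗ₜ g i y := by simp [hfg]
  convert h using 1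
  · ext x y z
    simp only [dL, dR, TensorProduct.AlgebraTensorModule.curry_apply, LinearMap.restrictScalars_self,
      TensorProduct.curry_apply, LinearMap.coe_comp, Function.comp_apply, LinearEquiv.coe_coe,
      TensorProduct.assoc_tmul, TensorProduct.map_tmul, hD', TensorProduct.tmul_sum,
      TensorProduct.sum_tmul, map_sum, TensorProduct.assoc_symm_tmul, LinearMap.id_apply,
      LinearMap.sum_apply, Module.End.mul_apply]
    exact Finset.sum_comm
  · congr 1
    · ext x y z
      simp only [t12, flipT, dR, TensorProduct.AlgebraTensorModule.curry_apply,
        LinearMap.restrictScalars_self,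
        TensorProduct.curry_apply, LinearMap.coe_comp, Function.comp_apply, LinearEquiv.coe_coe,
        TensorProduct.assoc_tmul, TensorProduct.map_tmul, hD', TensorProduct.tmul_sum,
        map_sum, TensorProduct.assoc_symm_tmul, LinearMap.id_apply,
        TensorProduct.comm_tmul, LinearMap.sum_apply, Module.End.mul_apply]
      exact Finset.sum_comm
    · ext x y z
      simp only [t23, flipT, dL, TensorProduct.AlgebraTensorModule.curry_apply,
        LinearMap.restrictScalars_self,
        TensorProduct.curry_apply, LinearMap.coe_comp, Function.comp_apply, LinearEquiv.coe_coe,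
        TensorProduct.assoc_tmul, TensorProduct.map_tmul, hD',
        TensorProduct.sum_tmul, map_sum, TensorProduct.assoc_symm_tmul, LinearMap.id_apply,
        TensorProduct.comm_tmul, LinearMap.sum_apply, Module.End.mul_apply]
      exact Finset.sum_comm

/-- The operator `α ↦ ∑ i, α (f i) • g i` attached to `D = ∑ i, f i ⊗ g i`. -/
noncomputable def sliceMap (f g : ι → End K V) : Dual K (End K V) →ₗ[K] End K V :=
  ∑ i, (Dual.eval K (End K V) (f i)).smulRight (g i)

theorem sliceMap_apply (f g : ι → End K V) (α : Dual K (End K V)) :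
    sliceMap f g α = ∑ i, α (f i) • g i := by
  simp [sliceMap]

/-- The Rota-Baxter identity of weight zero for the operator attached to a double Lie bracket. -/
theorem IsDoubleLie.sliceMap_mul [FiniteDimensional K V] (hD : IsDoubleLie D)
    (hfg : D = ∑ i, TensorProduct.map (f i) (g i)) (α β : Dual K (End K V)) :
    sliceMap f g β * sliceMap f g α =
      sliceMap f g (β ∘ₗ LinearMap.mulLeft K (sliceMap f g α)) +
        sliceMap f g (α ∘ₗ LinearMap.mulRight K (sliceMap f g β)) := by
  have h := congrArg (contractFst V (β ∘ₗ contractFst V α)) (hD.sum_map_mul hfg)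
  simp only [map_sum, map_add, contractFst_map, LinearMap.comp_apply, map_smul, smul_eq_mul] at h
  have h₁ : sliceMap f g (β ∘ₗ LinearMap.mulLeft K (sliceMap f g α)) =
      ∑ i, ∑ j, (α (f i) * β (g i * f j)) • g j := by
    simp only [sliceMap_apply, LinearMap.comp_apply, LinearMap.mulLeft_apply, Finset.sum_mul,
      smul_mul_assoc, map_sum, map_smul, smul_eq_mul, Finset.sum_smul]
    exact Finset.sum_comm
  have h₂ : sliceMap f g β * sliceMap f g α =
      ∑ i, ∑ j, (α (f j) * β (f i)) • (g i * g j) := by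
    simp only [sliceMap_apply, Finset.sum_mul_sum, smul_mul_smul_comm, mul_comm]
  have h₃ : sliceMap f g (α ∘ₗ LinearMap.mulRight K (sliceMap f g β)) =
      -∑ i, ∑ j, (α (f i * f j) * β (g j)) • g i := by
    rw [sliceMap_apply f g β, ← neg_eq_iff_eq_neg.mpr (hD.sum_smul_swap hfg β)]
    simp only [sliceMap_apply, LinearMap.comp_apply, LinearMap.mulRight_apply, mul_neg,
      Finset.mul_sum, mul_smul_comm, map_neg, map_sum, map_smul, smul_eq_mul, Finset.sum_smul,
      neg_smul, Finset.sum_neg_distrib, mul_comm]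
  rw [h₁, h₂, h₃, h, add_neg_cancel_right]

theorem IsDoubleLie.one_notMem_range_sliceMap [FiniteDimensional K V] [Nontrivial V]
    (hD : IsDoubleLie D) (hfg : D = ∑ i, TensorProduct.map (f i) (g i)) :
    (1 : End K V) ∉ LinearMap.range (sliceMap f g) := by
  rintro ⟨α, hα⟩
  have h := hD.sliceMap_mul hfg α α
  rw [hα, LinearMap.mulLeft_one, LinearMap.mulRight_one, LinearMap.comp_id, hα] at h
  simp at h

theorem IsDoubleLie.isDoubleIdeal (hD : IsDoubleLie D)
    (hfg : D = ∑ i, TensorProduct.map (f i) (g i)) {I : Submodule K V}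
    (hI : ∀ i, ∀ u ∈ I, g i u ∈ I) : IsDoubleIdeal D I := by
  have hR (x : V) (u : I) : D (x ⊗ₜ (u : V)) ∈ sideR I := by
    simp only [hfg, LinearMap.sum_apply, TensorProduct.map_tmul]
    exact Submodule.sum_mem _ fun i _ => ⟨f i x ⊗ₜ ⟨g i u, hI i u u.2⟩, by simp⟩
  have hflip (t : V ⊗[K] V) (ht : t ∈ sideR I) : flipT K V t ∈ sideL I := by
    obtain ⟨s, rfl⟩ := ht
    refine ⟨TensorProduct.comm K V I s, ?_⟩
    induction s with
    | zero => simp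
    | tmul x u => simp [flipT]
    | add a b ha hb => simp only [map_add, ha, hb]
  rw [IsDoubleIdeal, Submodule.map_sup]
  refine sup_le ?_ ?_
  · refine le_sup_of_le_left ?_
    rintro _ ⟨_, ⟨s, rfl⟩, rfl⟩
    induction s with
    | zero => simp
    | tmul u x =>
      have h := LinearMap.congr_fun hD.1 ((u : V) ⊗ₜ x)
      have h' : D ((u : V) ⊗ₜ x) = -flipT K V (D (x ⊗ₜ (u : V))) := by
        rw [eq_neg_iff_add_eq_zero, ← neg_eq_iff_add_eq_zero]
        simpa [flipT] using h.symm
      simpa [h'] using hflip _ (hR x u)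
    | add a b ha hb => simpa only [map_add] using add_mem ha hb
  · refine le_sup_of_le_right ?_
    rintro _ ⟨_, ⟨s, rfl⟩, rfl⟩
    induction s with
    | zero => simp
    | tmul x u => simpa using hR x u
    | add a b ha hb => simpa only [map_add] using add_mem ha hb

end DoubleLie

/-- Theorem 2: a finite-dimensional Lie double algebra of dimension `> 1` contains a
nonzero proper ideal. -/
theorem stmt7 {K V : Type*} [Field K] [AddCommGroup V] [Module K V]
    [FiniteDimensional K V] (hdim : 1 < Module.finrank K V)
    (D : V ⊗[K] V →ₗ[K] V ⊗[K] V) (hLie : IsDoubleLie D) :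
    ∃ I : Submodule K V, IsDoubleIdeal D I ∧ I ≠ ⊥ ∧ I ≠ ⊤ := by
  have : Nontrivial V := Module.nontrivial_of_finrank_pos (zero_lt_one.trans hdim)
  let e := finBasis K (End K V)
  obtain ⟨g, hg⟩ := exists_eq_sum_map_basis e D
  have hgmem (i) : g i ∈ LinearMap.range (sliceMap e g) :=
    ⟨e.coord i, by simp [sliceMap_apply, Finsupp.single_apply]⟩
  by_contra! hno
  have hirr : ∀ I : Submodule K V,
      (∀ b ∈ LinearMap.range (sliceMap e g), ∀ u ∈ I, b u ∈ I) → I = ⊥ ∨ I = ⊤ := fun I hI =>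
    or_iff_not_imp_left.mpr (hno I (hLie.isDoubleIdeal hg fun i => hI _ (hgmem i)))
  refine hLie.one_notMem_range_sliceMap hg (one_mem_of_irreducible _ ?_ ?_ hirr)
  · rintro _ ⟨β, rfl⟩ _ ⟨α, rfl⟩
    rw [hLie.sliceMap_mul hg]
    exact add_mem ⟨_, rfl⟩ ⟨_, rfl⟩
  · intro hbot
    obtain ⟨v, hv⟩ := exists_ne (0 : V)
    rcases hirr (K ∙ v) (by simp [hbot]) with h | h
    · exact hv (Submodule.span_singleton_eq_bot.mp h)
    · have h1 := finrank_span_singleton (K := K) hv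
      rw [h, finrank_top] at h1
      omega
end

section
/- Let K be a field, n a nonempty finite type, A = Matrix n n K, let R : A → A be a K-linear map with trace-form adjoint R*, and suppose both R and R* are left averaging: R(x)·R(y) = R(R(x)·y) and R*(x)·R*(y) = R*(R*(x)·y) for all x,y ∈ A. Let B = range R + range R* (a subspace of A). Then B is a subalgebra of A (a·b ∈ B for all a,b ∈ B), and range R and range R* are right ideals of B (a·b ∈ range R for all a ∈ range R, b ∈ B, and a·b ∈ range R* for all a ∈ range R*, b ∈ B). -/
/-- If `S` is the trace-form adjoint of a left averaging map `R`, then `S` commutes with right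
multiplication by elements of the range of `R`. -/
theorem traceAdjoint_mul_leftAveraging {K n : Type*} [Field K] [Fintype n] [DecidableEq n]
    (R S : Matrix n n K →ₗ[K] Matrix n n K)
    (hS : ∀ x y : Matrix n n K, (S x * y).trace = (x * R y).trace)
    (hR : ∀ x y : Matrix n n K, R x * R y = R (R x * y)) (z x : Matrix n n K) :
    S z * R x = S (z * R x) := by
  refine Matrix.ext_iff_trace_mul_right.mpr fun y => ?_
  rw [mul_assoc, hS, hS, ← hR, mul_assoc]

/-- If the ranges of `R` and `S` satisfy the mixed and pure averaging identities, then the range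
of `R` absorbs right multiplication by `range R + range S`. -/
theorem mul_mem_range_of_averaging {K A : Type*} [Field K] [Ring A] [Algebra K A]
    (R S : A →ₗ[K] A) (hR : ∀ x y, R x * R y = R (R x * y))
    (hRS : ∀ x y, R x * S y = R (x * S y)) {a b : A} (ha : a ∈ LinearMap.range R)
    (hb : b ∈ LinearMap.range R ⊔ LinearMap.range S) : a * b ∈ LinearMap.range R := by
  obtain ⟨x, rfl⟩ := ha
  obtain ⟨_, ⟨y, rfl⟩, _, ⟨z, rfl⟩, rfl⟩ := Submodule.mem_sup.mp hb
  rw [mul_add, hR, hRS]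
  exact add_mem ⟨_, rfl⟩ ⟨_, rfl⟩

/-- Lemma 3 (1),(2): if `R` and its trace-form adjoint `R*` are both left averaging on
`A = Matrix n n K`, then `B = range R + range R*` is a subalgebra of `A`, and `range R`
and `range R*` are right ideals of `B`. -/
theorem stmt10 {K : Type*} [Field K] {n : Type*} [Fintype n] [DecidableEq n] [Nonempty n]
    (R Rs : Matrix n n K →ₗ[K] Matrix n n K)
    (hRs : ∀ x y : Matrix n n K, (Rs x * y).trace = (x * R y).trace)
    (hR : ∀ x y : Matrix n n K, R x * R y = R (R x * y))
    (hRsAv : ∀ x y : Matrix n n K, Rs x * Rs y = Rs (Rs x * y)) :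
    (∀ a ∈ LinearMap.range R ⊔ LinearMap.range Rs,
      ∀ b ∈ LinearMap.range R ⊔ LinearMap.range Rs,
        a * b ∈ LinearMap.range R ⊔ LinearMap.range Rs) ∧
    (∀ a ∈ LinearMap.range R, ∀ b ∈ LinearMap.range R ⊔ LinearMap.range Rs,
        a * b ∈ LinearMap.range R) ∧
    (∀ a ∈ LinearMap.range Rs, ∀ b ∈ LinearMap.range R ⊔ LinearMap.range Rs,
        a * b ∈ LinearMap.range Rs) := by
  have hRs' : ∀ x y : Matrix n n K, (R x * y).trace = (x * Rs y).trace := fun x y => by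
    rw [Matrix.trace_mul_comm, ← hRs, Matrix.trace_mul_comm]
  have hr : ∀ a ∈ LinearMap.range R, ∀ b ∈ LinearMap.range R ⊔ LinearMap.range Rs,
      a * b ∈ LinearMap.range R := fun _ ha _ hb =>
    mul_mem_range_of_averaging R Rs hR (traceAdjoint_mul_leftAveraging Rs R hRs' hRsAv) ha hb
  have hrs : ∀ a ∈ LinearMap.range Rs, ∀ b ∈ LinearMap.range R ⊔ LinearMap.range Rs,
      a * b ∈ LinearMap.range Rs := fun _ ha _ hb =>
    mul_mem_range_of_averaging Rs R hRsAv (traceAdjoint_mul_leftAveraging R Rs hRs hR) ha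
      (sup_comm (LinearMap.range R) _ ▸ hb)
  refine ⟨fun a ha b hb => ?_, hr, hrs⟩
  obtain ⟨u, hu, v, hv, rfl⟩ := Submodule.mem_sup.mp ha
  rw [add_mul]
  exact Submodule.add_mem_sup (hr u hu b hb) (hrs v hv b hb)
end

section
/- Let K be a field, n a nonempty finite type, A = Matrix n n K, let R : A → A be a K-linear map with trace-form adjoint R*, and suppose both R and R* are left averaging: R(x)·R(y) = R(R(x)·y) and R*(x)·R*(y) = R*(R*(x)·y) for all x,y ∈ A. Let B = range R + range R*. Then: (i) ker R and ker R* are left B-submodules of A, i.e. b·x ∈ ker R for all b ∈ B, x ∈ ker R, and b·x ∈ ker R* for all b ∈ B, x ∈ ker R*; (ii) x·y ∈ ker R ∩ ker R* for all x ∈ ker R, y ∈ range R*; (iii) x·y ∈ ker R ∩ ker R* for all x ∈ ker R*, y ∈ range R. -/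
/-- If `R` is left averaging, then its trace-form adjoint `S` commutes with right multiplication
by elements of the range of `R`. -/
theorem traceAdjoint_mul_range {K n : Type*} [Field K] [Fintype n] [DecidableEq n]
    {R S : Matrix n n K →ₗ[K] Matrix n n K}
    (hS : ∀ x y : Matrix n n K, (S x * y).trace = (x * R y).trace)
    (hR : ∀ x y : Matrix n n K, R x * R y = R (R x * y)) (z x : Matrix n n K) :
    S (z * R x) = S z * R x := by
  refine Matrix.ext_iff_trace_mul_right.2 fun y => ?_
  rw [hS, mul_assoc, hR, ← hS, mul_assoc]

/-- If `R` is left averaging with trace-form adjoint `S`, then `S (R y * z) = S (y * S z)`. -/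
theorem traceAdjoint_range_mul {K n : Type*} [Field K] [Fintype n] [DecidableEq n]
    {R S : Matrix n n K →ₗ[K] Matrix n n K}
    (hS : ∀ x y : Matrix n n K, (S x * y).trace = (x * R y).trace)
    (hR : ∀ x y : Matrix n n K, R x * R y = R (R x * y)) (y z : Matrix n n K) :
    S (R y * z) = S (y * S z) := by
  refine Matrix.ext_iff_trace_mul_right.2 fun x => ?_
  rw [hS, hS, Matrix.trace_mul_comm, ← mul_assoc, hR, Matrix.trace_mul_comm, ← hS,
    Matrix.trace_mul_comm, mul_assoc, Matrix.trace_mul_comm]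

/-- Lemma 3 (3),(4),(5): if `R` and its trace-form adjoint `R*` are both left averaging on
`A = Matrix n n K` and `B = range R + range R*`, then `ker R` and `ker R*` are left
`B`-submodules of `A`, `ker R · range R* ⊆ ker R ∩ ker R*`, and
`ker R* · range R ⊆ ker R ∩ ker R*`. -/
theorem stmt11 {K : Type*} [Field K] {n : Type*} [Fintype n] [DecidableEq n] [Nonempty n]
    (R Rs : Matrix n n K →ₗ[K] Matrix n n K)
    (hRs : ∀ x y : Matrix n n K, (Rs x * y).trace = (x * R y).trace)
    (hR : ∀ x y : Matrix n n K, R x * R y = R (R x * y))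
    (hRsAv : ∀ x y : Matrix n n K, Rs x * Rs y = Rs (Rs x * y)) :
    (∀ b ∈ LinearMap.range R ⊔ LinearMap.range Rs,
      ∀ x ∈ LinearMap.ker R, b * x ∈ LinearMap.ker R) ∧
    (∀ b ∈ LinearMap.range R ⊔ LinearMap.range Rs,
      ∀ x ∈ LinearMap.ker Rs, b * x ∈ LinearMap.ker Rs) ∧
    (∀ x ∈ LinearMap.ker R, ∀ y ∈ LinearMap.range Rs,
      x * y ∈ LinearMap.ker R ⊓ LinearMap.ker Rs) ∧
    (∀ x ∈ LinearMap.ker Rs, ∀ y ∈ LinearMap.range R,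
      x * y ∈ LinearMap.ker R ⊓ LinearMap.ker Rs) := by
  have hRadj (x y : Matrix n n K) : (R x * y).trace = (x * Rs y).trace := by
    rw [Matrix.trace_mul_comm, ← hRs, Matrix.trace_mul_comm]
  simp only [Submodule.mem_sup, LinearMap.mem_range, LinearMap.mem_ker, Submodule.mem_inf]
  refine ⟨?_, ?_, ?_, ?_⟩
  · rintro _ ⟨_, ⟨a, rfl⟩, _, ⟨b, rfl⟩, rfl⟩ x hx
    rw [add_mul, map_add, ← hR, traceAdjoint_range_mul hRadj hRsAv, hx]
    simp
  · rintro _ ⟨_, ⟨a, rfl⟩, _, ⟨b, rfl⟩, rfl⟩ x hx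
    rw [add_mul, map_add, ← hRsAv, traceAdjoint_range_mul hRs hR, hx]
    simp
  · rintro x hx _ ⟨w, rfl⟩
    rw [traceAdjoint_mul_range hRadj hRsAv, ← traceAdjoint_range_mul hRs hR, hx]
    simp
  · rintro x hx _ ⟨w, rfl⟩
    rw [traceAdjoint_mul_range hRs hR, ← traceAdjoint_range_mul hRadj hRsAv, hx]
    simp
end

section
/- Let K be a field, n a nonempty finite type, A = Matrix n n K, let R : A → A be a K-linear map with trace-form adjoint R*, and suppose both R and R* are left averaging: R(x)·R(y) = R(R(x)·y) and R*(x)·R*(y) = R*(R*(x)·y) for all x,y ∈ A. If ker R = 0, then there exists α ∈ K with α ≠ 0 such that R(x) = α·x for all x ∈ A, and moreover R* = R. -/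
/-- Lemma 4: if `R` and its trace-form adjoint `R*` are both left averaging on
`A = Matrix n n K` and `ker R = 0`, then `R = R* = α·id` for some nonzero scalar `α`. -/
theorem stmt12 {K : Type*} [Field K] {n : Type*} [Fintype n] [DecidableEq n] [Nonempty n]
    (R Rs : Matrix n n K →ₗ[K] Matrix n n K)
    (hRs : ∀ x y : Matrix n n K, (Rs x * y).trace = (x * R y).trace)
    (hR : ∀ x y : Matrix n n K, R x * R y = R (R x * y))
    (hRsAv : ∀ x y : Matrix n n K, Rs x * Rs y = Rs (Rs x * y))
    (hker : LinearMap.ker R = ⊥) :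
    ∃ α : K, α ≠ 0 ∧ (∀ x : Matrix n n K, R x = α • x) ∧ Rs = R := by
  have hsurj : Function.Surjective R :=
    LinearMap.injective_iff_surjective.mp (LinearMap.ker_eq_bot.mp hker)
  have hRc : ∀ z, R z = z * R 1 := by
    intro z
    obtain ⟨x, rfl⟩ := hsurj z
    rw [hR, mul_one]
  obtain ⟨c, hc⟩ : ∃ c, R 1 = c := ⟨_, rfl⟩
  rw [hc] at hRc
  have hRsc : ∀ x, Rs x = c * x := by
    intro x
    refine Matrix.ext_iff_trace_mul_right.mpr fun y => ?_
    rw [hRs, hRc, ← mul_assoc, Matrix.trace_mul_comm, mul_assoc]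
  obtain ⟨w, hw⟩ : ∃ w, w * c = 1 := by
    obtain ⟨w, hw⟩ := hsurj 1
    exact ⟨w, by rw [← hRc, hw]⟩
  have hcomm : ∀ x, x * c = c * x := by
    intro x
    have h := congrArg (w * ·) (hRsAv x 1)
    simpa only [hRsc, mul_one, ← mul_assoc, hw, one_mul] using h
  obtain ⟨α, hα⟩ : c ∈ Set.range (Matrix.scalar n) :=
    Matrix.mem_range_scalar_of_commute_single fun i j _ => hcomm _
  have hsmul : ∀ x, c * x = α • x := by
    intro x
    rw [← hα, Matrix.scalar_apply, ← Matrix.smul_eq_diagonal_mul]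
  refine ⟨α, ?_, fun x => by rw [hRc, hcomm, hsmul], ?_⟩
  · rintro rfl
    rw [← hα, map_zero, mul_zero] at hw
    exact zero_ne_one hw
  · ext1 x
    rw [hRsc, hRc, hcomm]
end

section
/- Let K be a field, n a nonempty finite type, A = Matrix n n K, let R : A → A be a K-linear map with trace-form adjoint R*, and suppose both R and R* are left averaging: R(x)·R(y) = R(R(x)·y) and R*(x)·R*(y) = R*(R*(x)·y) for all x,y ∈ A. If range R + range R* = A, then ker R = 0. -/
namespace Matrix

/-- The full matrix ring over a domain is a prime ring. -/
theorem eq_zero_or_eq_zero_of_forall_mul_mul_eq_zero {K n : Type*} [Field K] [Fintype n]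
    [DecidableEq n] {c b : Matrix n n K} (h : ∀ a, c * a * b = 0) : c = 0 ∨ b = 0 := by
  by_contra! hcb
  obtain ⟨hc, hb⟩ := hcb
  apply hc
  ext k i
  by_contra hki
  apply hb
  ext j l
  have hkl := congrFun (congrFun (h (single i j 1)) k) l
  rw [mul_assoc, mul_apply, Finset.sum_eq_single i] at hkl
  · simpa using (mul_eq_zero.mp hkl).resolve_left hki
  · intro m _ hm
    simp [single_mul_apply_of_ne _ _ _ _ _ hm]
  · simp

end Matrix

section TraceAdjoint

variable {K n : Type*} [Field K] [Fintype n]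
  {R Rs : Matrix n n K →ₗ[K] Matrix n n K}

theorem trace_adjoint_symm (hRs : ∀ x y, (Rs x * y).trace = (x * R y).trace)
    (x y : Matrix n n K) : (R x * y).trace = (x * Rs y).trace := by
  rw [Matrix.trace_mul_comm, ← hRs, Matrix.trace_mul_comm]

/-- If the trace adjoint `Rs` is left averaging, then `R` is right linear over `range Rs`. -/
theorem map_mul_adjoint (hRs : ∀ x y, (Rs x * y).trace = (x * R y).trace)
    (hRsAv : ∀ x y, Rs x * Rs y = Rs (Rs x * y)) (x z : Matrix n n K) :
    R (x * Rs z) = R x * Rs z := by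
  refine Matrix.ext_iff_trace_mul_left.mpr fun w => ?_
  rw [← hRs, ← mul_assoc, Matrix.trace_mul_comm, ← mul_assoc, hRsAv, hRs, mul_assoc,
    Matrix.trace_mul_comm, mul_assoc]

theorem mul_mem_range_of_leftAveraging (hRs : ∀ x y, (Rs x * y).trace = (x * R y).trace)
    (hR : ∀ x y, R x * R y = R (R x * y)) (hRsAv : ∀ x y, Rs x * Rs y = Rs (Rs x * y))
    (hsum : LinearMap.range R ⊔ LinearMap.range Rs = ⊤) (x a : Matrix n n K) :
    ∃ y, R y = R x * a := by
  have ha : a ∈ LinearMap.range R ⊔ LinearMap.range Rs := hsum ▸ Submodule.mem_top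
  obtain ⟨_, ⟨u, rfl⟩, _, ⟨v, rfl⟩, rfl⟩ := Submodule.mem_sup.mp ha
  exact ⟨R x * u + x * Rs v, by rw [map_add, ← hR, map_mul_adjoint hRs hRsAv, mul_add]⟩

theorem eq_zero_of_adjoint_eq_zero (hRs : ∀ x y, (Rs x * y).trace = (x * R y).trace)
    (h : Rs = 0) : R = 0 := by
  ext1 y
  refine Matrix.ext_iff_trace_mul_left.mpr fun x => ?_
  simp [← hRs, h]

end TraceAdjoint

/-- Proposition 2: if `R` and its trace-form adjoint `R*` are both left averaging on
`A = Matrix n n K` and `range R + range R* = A`, then `ker R = 0`. -/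
theorem stmt13 {K : Type*} [Field K] {n : Type*} [Fintype n] [DecidableEq n] [Nonempty n]
    (R Rs : Matrix n n K →ₗ[K] Matrix n n K)
    (hRs : ∀ x y : Matrix n n K, (Rs x * y).trace = (x * R y).trace)
    (hR : ∀ x y : Matrix n n K, R x * R y = R (R x * y))
    (hRsAv : ∀ x y : Matrix n n K, Rs x * Rs y = Rs (Rs x * y))
    (hsum : LinearMap.range R ⊔ LinearMap.range Rs = ⊤) :
    LinearMap.ker R = ⊥ := by
  have hRs' := trace_adjoint_symm hRs
  have ideal := mul_mem_range_of_leftAveraging hRs hR hRsAv hsum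
  have ideal' := mul_mem_range_of_leftAveraging hRs' hRsAv hR (by rwa [sup_comm])
  have hR0 : R ≠ 0 := by
    intro h
    have h' := eq_zero_of_adjoint_eq_zero hRs' h
    subst h h'
    simp at hsum
  have hRs0 : Rs ≠ 0 := fun h => hR0 (eq_zero_of_adjoint_eq_zero hRs h)
  obtain ⟨x₀, hx₀⟩ := DFunLike.ne_iff.mp hR0
  obtain ⟨z₀, hz₀⟩ := DFunLike.ne_iff.mp hRs0
  -- an element of `range R` annihilating `range R` from the left vanishes
  have annihilator (u : Matrix n n K) (hu : ∀ x, R u * R x = 0) : R u = 0 := by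
    refine (Matrix.eq_zero_or_eq_zero_of_forall_mul_mul_eq_zero fun a => ?_).resolve_left hz₀
    obtain ⟨z, hz⟩ := ideal' z₀ a
    rw [← hz]
    refine Matrix.ext_iff_trace_mul_right.mpr fun x => ?_
    rw [mul_assoc, hRs, ← hR, hu]
    simp
  have injective : Function.Injective Rs := by
    rw [← LinearMap.ker_eq_bot, LinearMap.ker_eq_bot']
    intro z hz
    have hzR (y : Matrix n n K) : z * R y = 0 := by
      refine Matrix.ext_iff_trace_mul_right.mpr fun a => ?_
      obtain ⟨w, hw⟩ := ideal y a
      rw [mul_assoc, ← hw, ← hRs, hz]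
      simp
    refine (Matrix.eq_zero_or_eq_zero_of_forall_mul_mul_eq_zero fun a => ?_).resolve_left hx₀
    obtain ⟨v, hv⟩ := ideal x₀ (a * z)
    rw [mul_assoc, ← hv]
    refine annihilator v fun x => ?_
    rw [hv, mul_assoc, mul_assoc, hzR]
    simp
  have surjective := LinearMap.surjective_of_injective injective
  rw [LinearMap.ker_eq_bot']
  intro y hy
  refine Matrix.ext_iff_trace_mul_left.mpr fun a => ?_
  obtain ⟨x, rfl⟩ := surjective a
  rw [hRs, hy]
  simp
end

section
/- Let K be an algebraically closed field, V a finite-dimensional K-vector space, and D : V ⊗[K] V → V ⊗[K] V a double bracket satisfying the double associativity identities such that the double algebra (V, D) is simple. Then finrank K V = 1 and there exists α ∈ K with α ≠ 0 such that D(w) = α·w for all w ∈ V⊗V (i.e., the double bracket is ⟦u,v⟧ = α·(u⊗v)). -/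
open TensorProduct

/-- Burnside's theorem: a subalgebra of `End V` without nontrivial invariant subspaces is
everything, for `V` finite-dimensional over an algebraically closed field. -/
theorem Subalgebra.eq_top_of_invariant_eq_bot_or_top {K V : Type*} [Field K] [IsAlgClosed K]
    [AddCommGroup V] [Module K V] [FiniteDimensional K V] [Nontrivial V]
    (S : Subalgebra K (Module.End K V))
    (hS : ∀ I : Submodule K V, (∀ f ∈ S, ∀ v ∈ I, f v ∈ I) → I = ⊥ ∨ I = ⊤) : S = ⊤ := by
  have hsimple : IsSimpleModule S V := by
    refine (isSimpleModule_iff S V).2 { eq_bot_or_eq_top := fun I => ?_ }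
    rcases hS (I.restrictScalars K) (fun f hf v hv => I.smul_mem ⟨f, hf⟩ hv) with h | h
    · exact Or.inl (by simpa using h)
    · exact Or.inr (by simpa using h)
  have hscalar := IsSimpleModule.algebraMap_end_bijective_of_isAlgClosed (A := S) (V := V) K
  refine Algebra.eq_top_iff.2 fun f => ?_
  let g : Module.End (Module.End S V) V :=
    { toFun := f
      map_add' := f.map_add
      map_smul' := fun c v => by
        obtain ⟨k, rfl⟩ := hscalar.2 c
        simp }
  obtain ⟨s, hs⟩ := Module.finite_def.1 (inferInstance : Module.Finite K V)
  obtain ⟨r, hr⟩ := jacobson_density g s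
  have : (r : Module.End K V) = f :=
    LinearMap.ext_on hs fun v hv => (hr v hv).symm
  exact this ▸ r.2

section Slices

variable {K V : Type*} [Field K] [AddCommGroup V] [Module K V]

/-- The contraction `id ⊗ φ : V ⊗ V → V`. -/
noncomputable def sliceFst (φ : Module.Dual K V) : V ⊗[K] V →ₗ[K] V :=
  (TensorProduct.rid K V).toLinearMap ∘ₗ φ.lTensor V

/-- The contraction `φ ⊗ id : V ⊗ V → V`. -/
noncomputable def sliceSnd (φ : Module.Dual K V) : V ⊗[K] V →ₗ[K] V :=
  (TensorProduct.lid K V).toLinearMap ∘ₗ φ.rTensor V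

@[simp] theorem sliceFst_tmul (φ : Module.Dual K V) (v w : V) :
    sliceFst φ (v ⊗ₜ w) = φ w • v := by simp [sliceFst]

@[simp] theorem sliceSnd_tmul (φ : Module.Dual K V) (v w : V) :
    sliceSnd φ (v ⊗ₜ w) = φ v • w := by simp [sliceSnd]

theorem sliceFst_rTensor (φ : Module.Dual K V) (a : Module.End K V) (t : V ⊗[K] V) :
    sliceFst φ (a.rTensor V t) = a (sliceFst φ t) := by
  induction t with
  | zero => simp
  | tmul v w => simp
  | add x y hx hy => simp only [map_add, hx, hy]

theorem sliceFst_lTensor (φ : Module.Dual K V) (a : Module.End K V) (t : V ⊗[K] V) :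
    sliceFst φ (a.lTensor V t) = sliceFst (φ ∘ₗ a) t := by
  induction t with
  | zero => simp
  | tmul v w => simp
  | add x y hx hy => simp only [map_add, hx, hy]

theorem sliceSnd_lTensor (φ : Module.Dual K V) (a : Module.End K V) (t : V ⊗[K] V) :
    sliceSnd φ (a.lTensor V t) = a (sliceSnd φ t) := by
  induction t with
  | zero => simp
  | tmul v w => simp
  | add x y hx hy => simp only [map_add, hx, hy]

theorem sliceSnd_rTensor (φ : Module.Dual K V) (a : Module.End K V) (t : V ⊗[K] V) :
    sliceSnd φ (a.rTensor V t) = sliceSnd (φ ∘ₗ a) t := by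
  induction t with
  | zero => simp
  | tmul v w => simp
  | add x y hx hy => simp only [map_add, hx, hy]

theorem tmul_mem_sideL {I : Submodule K V} {v : V} (hv : v ∈ I) (w : V) :
    v ⊗ₜ[K] w ∈ sideL I :=
  ⟨⟨v, hv⟩ ⊗ₜ w, by simp⟩

theorem tmul_mem_sideR {I : Submodule K V} (v : V) {w : V} (hw : w ∈ I) :
    v ⊗ₜ[K] w ∈ sideR I :=
  ⟨v ⊗ₜ ⟨w, hw⟩, by simp⟩

theorem mem_sideL_of_sliceFst_mem [FiniteDimensional K V] {I : Submodule K V}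
    {t : V ⊗[K] V} (h : ∀ φ, sliceFst φ t ∈ I) : t ∈ sideL I := by
  let e := Module.finBasis K V
  have key : t = ∑ j, sliceFst (e.coord j) t ⊗ₜ[K] e j := by
    clear h
    induction t with
    | zero => simp
    | tmul v w =>
      nth_rw 1 [← e.sum_repr w]
      simp only [TensorProduct.tmul_sum, sliceFst_tmul, TensorProduct.smul_tmul,
        Module.Basis.coord_apply]
    | add x y hx hy =>
      simp only [map_add, TensorProduct.add_tmul, Finset.sum_add_distrib, ← hx, ← hy]
  rw [key]
  exact Submodule.sum_mem _ fun j _ => tmul_mem_sideL (h _) _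

theorem mem_sideR_of_sliceSnd_mem [FiniteDimensional K V] {I : Submodule K V}
    {t : V ⊗[K] V} (h : ∀ φ, sliceSnd φ t ∈ I) : t ∈ sideR I := by
  let e := Module.finBasis K V
  have key : t = ∑ j, e j ⊗ₜ[K] sliceSnd (e.coord j) t := by
    clear h
    induction t with
    | zero => simp
    | tmul v w =>
      nth_rw 1 [← e.sum_repr v]
      simp only [TensorProduct.sum_tmul, sliceSnd_tmul, TensorProduct.smul_tmul,
        Module.Basis.coord_apply]
    | add x y hx hy =>
      simp only [map_add, TensorProduct.tmul_add, Finset.sum_add_distrib, ← hx, ← hy]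
  rw [key]
  exact Submodule.sum_mem _ fun j _ => tmul_mem_sideR _ (h _)

theorem rTensor_mem_sideL {I : Submodule K V} {p : Module.End K V} (hp : ∀ v, p v ∈ I)
    (t : V ⊗[K] V) : p.rTensor V t ∈ sideL I := by
  induction t with
  | zero => simp
  | tmul v w => exact tmul_mem_sideL (hp v) w
  | add x y hx hy => simpa using add_mem hx hy

theorem lTensor_mem_sideR {I : Submodule K V} {p : Module.End K V} (hp : ∀ v, p v ∈ I)
    (t : V ⊗[K] V) : p.lTensor V t ∈ sideR I := by
  induction t with
  | zero => simp
  | tmul v w => exact tmul_mem_sideR v (hp w)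
  | add x y hx hy => simpa using add_mem hx hy

end Slices

section DoubleBracket

variable {K V : Type*} [Field K] [AddCommGroup V] [Module K V] (D : V ⊗[K] V →ₗ[K] V ⊗[K] V)

/-- The operator `v ↦ (id ⊗ φ) (D (v ⊗ w))`. -/
noncomputable def opFst (φ : Module.Dual K V) (w : V) : Module.End K V :=
  sliceFst φ ∘ₗ D ∘ₗ (TensorProduct.mk K V V).flip w

/-- The operator `w ↦ (φ ⊗ id) (D (v ⊗ w))`. -/
noncomputable def opSnd (φ : Module.Dual K V) (v : V) : Module.End K V :=
  sliceSnd φ ∘ₗ D ∘ₗ TensorProduct.mk K V V v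

@[simp] theorem opFst_apply (φ : Module.Dual K V) (v w : V) :
    opFst D φ w v = sliceFst φ (D (v ⊗ₜ w)) := rfl

@[simp] theorem opSnd_apply (φ : Module.Dual K V) (v w : V) :
    opSnd D φ v w = sliceSnd φ (D (v ⊗ₜ w)) := rfl

/-- The span of the first tensor factors of `D`, seen as an element of `End V ⊗ End V`. -/
noncomputable def spanFst : Submodule K (Module.End K V) :=
  Submodule.span K {a | ∃ φ w, opFst D φ w = a}

/-- The span of the second tensor factors of `D`, seen as an element of `End V ⊗ End V`. -/
noncomputable def spanSnd : Submodule K (Module.End K V) :=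
  Submodule.span K {b | ∃ φ v, opSnd D φ v = b}

variable {D}

theorem opFst_mem_spanFst (φ : Module.Dual K V) (w : V) : opFst D φ w ∈ spanFst D :=
  Submodule.subset_span ⟨φ, w, rfl⟩

theorem opSnd_mem_spanSnd (φ : Module.Dual K V) (v : V) : opSnd D φ v ∈ spanSnd D :=
  Submodule.subset_span ⟨φ, v, rfl⟩

theorem isDoubleIdeal_of_tmul_mem {I : Submodule K V}
    (hL : ∀ v ∈ I, ∀ w, D (v ⊗ₜ w) ∈ sideL I ⊔ sideR I)
    (hR : ∀ v, ∀ w ∈ I, D (v ⊗ₜ w) ∈ sideL I ⊔ sideR I) : IsDoubleIdeal D I := by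
  refine Submodule.map_le_iff_le_comap.2 (sup_le ?_ ?_)
  · rintro _ ⟨t, rfl⟩
    induction t with
    | zero => simp
    | tmul v w => simpa using hL v v.2 w
    | add x y hx hy => simpa using add_mem hx hy
  · rintro _ ⟨t, rfl⟩
    induction t with
    | zero => simp
    | tmul v w => simpa using hR v w w.2
    | add x y hx hy => simpa using add_mem hx hy

theorem isDoubleIdeal_of_invariant [FiniteDimensional K V] {I : Submodule K V}
    (hL : ∀ a ∈ spanFst D, ∀ v ∈ I, a v ∈ I) (hR : ∀ b ∈ spanSnd D, ∀ v ∈ I, b v ∈ I) :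
    IsDoubleIdeal D I :=
  isDoubleIdeal_of_tmul_mem
    (fun v hv w => Submodule.mem_sup_left <|
      mem_sideL_of_sliceFst_mem fun φ => hL _ (opFst_mem_spanFst φ w) v hv)
    (fun v w hw => Submodule.mem_sup_right <|
      mem_sideR_of_sliceSnd_mem fun φ => hR _ (opSnd_mem_spanSnd φ v) w hw)

theorem IsSimpleDouble.eq_top_of_forall_mem (h : IsSimpleDouble D) {U : Submodule K V}
    (hU : ∀ t, D t ∈ sideL U ⊔ sideR U) : U = ⊤ := by
  refine (h.2 U (isDoubleIdeal_of_tmul_mem (fun _ _ _ => hU _) fun _ _ _ => hU _)).resolve_left ?_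
  rintro rfl
  refine h.1 (LinearMap.ext fun t => ?_)
  have hL : sideL (⊥ : Submodule K V) = ⊥ := by
    rw [sideL, Subsingleton.elim (⊥ : Submodule K V).subtype 0, TensorProduct.map_zero_left,
      LinearMap.range_zero]
  have hR : sideR (⊥ : Submodule K V) = ⊥ := by
    rw [sideR, Subsingleton.elim (⊥ : Submodule K V).subtype 0, TensorProduct.map_zero_right,
      LinearMap.range_zero]
  simpa [hL, hR] using hU t

theorem IsSimpleDouble.eq_top_of_spanFst [FiniteDimensional K V] (h : IsSimpleDouble D)
    {U : Submodule K V} (hU : ∀ a ∈ spanFst D, ∀ x, a x ∈ U) : U = ⊤ := by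
  refine h.eq_top_of_forall_mem fun t => Submodule.mem_sup_left ?_
  induction t with
  | zero => simp
  | tmul v w => exact mem_sideL_of_sliceFst_mem fun φ => hU _ (opFst_mem_spanFst φ w) v
  | add x y hx hy => simpa using add_mem hx hy

theorem IsSimpleDouble.eq_top_of_spanSnd [FiniteDimensional K V] (h : IsSimpleDouble D)
    {U : Submodule K V} (hU : ∀ b ∈ spanSnd D, ∀ x, b x ∈ U) : U = ⊤ := by
  refine h.eq_top_of_forall_mem fun t => Submodule.mem_sup_right ?_
  induction t with
  | zero => simp
  | tmul v w => exact mem_sideR_of_sliceSnd_mem fun φ => hU _ (opSnd_mem_spanSnd φ v) w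
  | add x y hx hy => simpa using add_mem hx hy

theorem IsDoubleAssoc.rTensor_opFst (h : IsDoubleAssoc D) (φ : Module.Dual K V) (w : V) :
    (opFst D φ w).rTensor V ∘ₗ D = D ∘ₗ (opFst D φ w).lTensor V := by
  let Φ : (V ⊗[K] V) ⊗[K] V →ₗ[K] V ⊗[K] V :=
    (TensorProduct.rid K (V ⊗[K] V)).toLinearMap ∘ₗ φ.lTensor (V ⊗[K] V)
  have hΦ (s : V ⊗[K] V) (y : V) : Φ (s ⊗ₜ y) = φ y • s := by simp [Φ]
  have hD (s : (V ⊗[K] V) ⊗[K] V) : Φ (dL D s) = D (Φ s) := by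
    induction s with
    | zero => simp
    | tmul s y => simp [hΦ, dL]
    | add x y hx hy => simp only [map_add, hx, hy]
  have hassoc (u : V) (t : V ⊗[K] V) :
      Φ ((TensorProduct.assoc K V V V).symm (u ⊗ₜ t)) = u ⊗ₜ sliceFst φ t := by
    induction t with
    | zero => simp
    | tmul x y => simp [hΦ]
    | add x y hx hy => simp only [map_add, TensorProduct.tmul_add, hx, hy]
  have hflip (s : V ⊗[K] V) (y : V) : Φ (t23 K V (s ⊗ₜ y)) = sliceFst φ s ⊗ₜ y := by
    induction s with
    | zero => simp
    | tmul x z => simp [hΦ, t23, flipT, TensorProduct.smul_tmul']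
    | add x y hx hy => simp only [map_add, TensorProduct.add_tmul, hx, hy]
  have hop (t : V ⊗[K] V) :
      Φ (t23 K V (dL D (t23 K V (t ⊗ₜ w)))) = (opFst D φ w).rTensor V t := by
    induction t with
    | zero => simp
    | tmul x y =>
      have : t23 K V ((x ⊗ₜ y) ⊗ₜ w) = (x ⊗ₜ w) ⊗ₜ y := by simp [t23, flipT]
      rw [this]
      simp [dL, hflip]
    | add x y hx hy => simp only [map_add, TensorProduct.add_tmul, hx, hy]
  refine TensorProduct.ext' fun u v => ?_
  have key := congrArg Φ (LinearMap.congr_fun h.1 ((u ⊗ₜ v) ⊗ₜ w))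
  simp only [LinearMap.comp_apply] at key
  rw [hD, show dL D ((u ⊗ₜ v) ⊗ₜ w) = D (u ⊗ₜ v) ⊗ₜ w by simp [dL], hop,
    show dR D ((u ⊗ₜ v) ⊗ₜ w) = (TensorProduct.assoc K V V V).symm (u ⊗ₜ D (v ⊗ₜ w)) by
      simp [dR], hassoc] at key
  simpa using key.symm

theorem IsDoubleAssoc.lTensor_opSnd (h : IsDoubleAssoc D) (φ : Module.Dual K V) (u : V) :
    (opSnd D φ u).lTensor V ∘ₗ D = D ∘ₗ (opSnd D φ u).rTensor V := by
  let Φ : (V ⊗[K] V) ⊗[K] V →ₗ[K] V ⊗[K] V :=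
    (TensorProduct.lid K (V ⊗[K] V)).toLinearMap ∘ₗ φ.rTensor (V ⊗[K] V) ∘ₗ
      (TensorProduct.assoc K V V V).toLinearMap
  have hΦ (x : V) (s : V ⊗[K] V) :
      Φ ((TensorProduct.assoc K V V V).symm (x ⊗ₜ s)) = φ x • s := by simp [Φ]
  have hD (s : (V ⊗[K] V) ⊗[K] V) : Φ (dR D s) = D (Φ s) := by
    obtain ⟨s, rfl⟩ := (TensorProduct.assoc K V V V).symm.surjective s
    induction s with
    | zero => simp
    | tmul x s => simp [hΦ, dR]
    | add x y hx hy => simp only [map_add, hx, hy]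
  have hassoc (t : V ⊗[K] V) (w : V) : Φ (t ⊗ₜ w) = sliceSnd φ t ⊗ₜ w := by
    induction t with
    | zero => simp
    | tmul x y => simp [Φ, TensorProduct.smul_tmul']
    | add x y hx hy => simp only [map_add, TensorProduct.add_tmul, hx, hy]
  have hflip (x : V) (s : V ⊗[K] V) :
      Φ (t12 K V ((TensorProduct.assoc K V V V).symm (x ⊗ₜ s))) = x ⊗ₜ sliceSnd φ s := by
    induction s with
    | zero => simp
    | tmul y z => simp [Φ, t12, flipT]
    | add x y hx hy => simp only [map_add, TensorProduct.tmul_add, hx, hy]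
  have hop (t : V ⊗[K] V) :
      Φ (t12 K V (dR D (t12 K V ((TensorProduct.assoc K V V V).symm (u ⊗ₜ t))))) =
        (opSnd D φ u).lTensor V t := by
    induction t with
    | zero => simp
    | tmul x y =>
      have : dR D (t12 K V ((TensorProduct.assoc K V V V).symm (u ⊗ₜ (x ⊗ₜ y)))) =
          (TensorProduct.assoc K V V V).symm (x ⊗ₜ D (u ⊗ₜ y)) := by simp [t12, flipT, dR]
      rw [this, hflip]
      simp
    | add x y hx hy => simp only [map_add, TensorProduct.tmul_add, hx, hy]
  refine TensorProduct.ext' fun v w => ?_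
  have key := congrArg Φ (LinearMap.congr_fun h.2 ((u ⊗ₜ v) ⊗ₜ w))
  simp only [LinearMap.comp_apply] at key
  rw [hD, show dL D ((u ⊗ₜ v) ⊗ₜ w) = D (u ⊗ₜ v) ⊗ₜ w by simp [dL], hassoc,
    show dR D ((u ⊗ₜ v) ⊗ₜ w) = (TensorProduct.assoc K V V V).symm (u ⊗ₜ D (v ⊗ₜ w)) by
      simp [dR], hop] at key
  simpa using key

theorem IsDoubleAssoc.rTensor_comm (h : IsDoubleAssoc D) {a : Module.End K V}
    (ha : a ∈ spanFst D) (t : V ⊗[K] V) : a.rTensor V (D t) = D (a.lTensor V t) := by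
  induction ha using Submodule.span_induction with
  | mem a ha =>
    obtain ⟨φ, w, rfl⟩ := ha
    exact congr($(h.rTensor_opFst φ w) t)
  | zero => simp
  | add a b _ _ ha hb => simp [LinearMap.rTensor_add, LinearMap.lTensor_add, ha, hb]
  | smul c a _ ha => simp [LinearMap.rTensor_smul, LinearMap.lTensor_smul, ha]

theorem IsDoubleAssoc.lTensor_comm (h : IsDoubleAssoc D) {b : Module.End K V}
    (hb : b ∈ spanSnd D) (t : V ⊗[K] V) : b.lTensor V (D t) = D (b.rTensor V t) := by
  induction hb using Submodule.span_induction with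
  | mem b hb =>
    obtain ⟨φ, v, rfl⟩ := hb
    exact congr($(h.lTensor_opSnd φ v) t)
  | zero => simp
  | add a b _ _ ha hb => simp [LinearMap.rTensor_add, LinearMap.lTensor_add, ha, hb]
  | smul c a _ ha => simp [LinearMap.rTensor_smul, LinearMap.lTensor_smul, ha]

theorem IsDoubleAssoc.spanFst_mul_mem (h : IsDoubleAssoc D) {a b : Module.End K V}
    (ha : a ∈ spanFst D) (hb : b ∈ spanFst D) : a * b ∈ spanFst D := by
  induction hb using Submodule.span_induction with
  | mem b hb =>
    obtain ⟨φ, w, rfl⟩ := hb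
    have : a * opFst D φ w = opFst D φ (a w) := LinearMap.ext fun v => by
      simp [← sliceFst_rTensor, h.rTensor_comm ha]
    exact this ▸ opFst_mem_spanFst _ _
  | zero => simp
  | add x y _ _ hx hy => simpa [mul_add] using add_mem hx hy
  | smul c x _ hx => simpa using Submodule.smul_mem _ c hx

theorem IsDoubleAssoc.spanSnd_mul_mem (h : IsDoubleAssoc D) {a b : Module.End K V}
    (ha : a ∈ spanSnd D) (hb : b ∈ spanSnd D) : a * b ∈ spanSnd D := by
  induction hb using Submodule.span_induction with
  | mem b hb =>
    obtain ⟨φ, w, rfl⟩ := hb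
    have : a * opSnd D φ w = opSnd D φ (a w) := LinearMap.ext fun v => by
      simp [← sliceSnd_lTensor, h.lTensor_comm ha]
    exact this ▸ opSnd_mem_spanSnd _ _
  | zero => simp
  | add x y _ _ hx hy => simpa [mul_add] using add_mem hx hy
  | smul c x _ hx => simpa using Submodule.smul_mem _ c hx

theorem IsDoubleAssoc.spanFst_mul_spanSnd_mem (h : IsDoubleAssoc D) {a b : Module.End K V}
    (ha : a ∈ spanFst D) (hb : b ∈ spanSnd D) : a * b ∈ spanFst D := by
  induction ha using Submodule.span_induction with
  | mem a ha =>
    obtain ⟨φ, w, rfl⟩ := ha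
    have : opFst D φ w * b = opFst D (φ ∘ₗ b) w := LinearMap.ext fun v => by
      simp [← sliceFst_lTensor, h.lTensor_comm hb]
    exact this ▸ opFst_mem_spanFst _ _
  | zero => simp
  | add x y _ _ hx hy => simpa [add_mul] using add_mem hx hy
  | smul c x _ hx => simpa using Submodule.smul_mem _ c hx

theorem IsDoubleAssoc.spanSnd_mul_spanFst_mem (h : IsDoubleAssoc D) {a b : Module.End K V}
    (ha : a ∈ spanSnd D) (hb : b ∈ spanFst D) : a * b ∈ spanSnd D := by
  induction ha using Submodule.span_induction with
  | mem a ha =>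
    obtain ⟨φ, w, rfl⟩ := ha
    have : opSnd D φ w * b = opSnd D (φ ∘ₗ b) w := LinearMap.ext fun v => by
      simp [← sliceSnd_rTensor, h.rTensor_comm hb]
    exact this ▸ opSnd_mem_spanSnd _ _
  | zero => simp
  | add x y _ _ hx hy => simpa [add_mul] using add_mem hx hy
  | smul c x _ hx => simpa using Submodule.smul_mem _ c hx

/-- The subalgebra of operators stabilizing `L` under right multiplication. -/
def rightIdealizer (L : Submodule K (Module.End K V)) : Subalgebra K (Module.End K V) where
  carrier := {c | ∀ a ∈ L, a * c ∈ L}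
  mul_mem' hx hy a ha := by simpa [mul_assoc] using hy _ (hx a ha)
  add_mem' hx hy a ha := by simpa [mul_add] using add_mem (hx a ha) (hy a ha)
  algebraMap_mem' r a ha := by
    simpa [← Algebra.commutes, ← Algebra.smul_def] using L.smul_mem r ha

theorem mem_rightIdealizer {L : Submodule K (Module.End K V)} {c : Module.End K V} :
    c ∈ rightIdealizer L ↔ ∀ a ∈ L, a * c ∈ L := Iff.rfl

theorem eq_top_of_rightIdealizer_eq_top [FiniteDimensional K V]
    {L : Submodule K (Module.End K V)} (hL : rightIdealizer L = ⊤)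
    (hV : ∀ U : Submodule K V, (∀ a ∈ L, ∀ x, a x ∈ U) → U = ⊤) : L = ⊤ := by
  let U : Submodule K V :=
    ⨅ φ : Module.Dual K V, L.comap (LinearMap.smulRightₗ (R := K) (M := V) (M₂ := V) φ)
  have hU : U = ⊤ := hV U fun a ha x => by
    refine Submodule.mem_iInf _ |>.2 fun φ => ?_
    have : φ.smulRight (a x) = a * φ.smulRight x := LinearMap.ext fun v => by simp
    change φ.smulRight (a x) ∈ L
    exact this ▸ mem_rightIdealizer.1 (hL ▸ Algebra.mem_top) a ha
  refine (Submodule.eq_top_iff').2 fun f => ?_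
  let e := Module.finBasis K V
  have hf : f = ∑ j, (e.coord j).smulRight (f (e j)) := e.ext fun i => by
    simp [LinearMap.sum_apply, Finsupp.single_apply]
  rw [hf]
  exact Submodule.sum_mem _ fun j _ =>
    (Submodule.mem_iInf _).1 (hU ▸ Submodule.mem_top : f (e j) ∈ U) (e.coord j)

theorem IsSimpleDouble.eq_top_of_spans_le [IsAlgClosed K] [FiniteDimensional K V] [Nontrivial V]
    (h : IsSimpleDouble D) {S : Subalgebra K (Module.End K V)}
    (hL : ∀ a ∈ spanFst D, a ∈ S) (hR : ∀ b ∈ spanSnd D, b ∈ S) : S = ⊤ :=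
  S.eq_top_of_invariant_eq_bot_or_top fun I hI => h.2 I <|
    isDoubleIdeal_of_invariant (fun a ha => hI a (hL a ha)) fun b hb => hI b (hR b hb)

theorem IsDoubleAssoc.spanFst_eq_top [IsAlgClosed K] [FiniteDimensional K V] [Nontrivial V]
    (h : IsDoubleAssoc D) (hs : IsSimpleDouble D) : spanFst D = ⊤ :=
  eq_top_of_rightIdealizer_eq_top
    (hs.eq_top_of_spans_le (fun _ hb _ ha => h.spanFst_mul_mem ha hb)
      fun _ hb _ ha => h.spanFst_mul_spanSnd_mem ha hb)
    fun _ => hs.eq_top_of_spanFst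

theorem IsDoubleAssoc.spanSnd_eq_top [IsAlgClosed K] [FiniteDimensional K V] [Nontrivial V]
    (h : IsDoubleAssoc D) (hs : IsSimpleDouble D) : spanSnd D = ⊤ :=
  eq_top_of_rightIdealizer_eq_top
    (hs.eq_top_of_spans_le (fun _ hb _ ha => h.spanSnd_mul_spanFst_mem ha hb)
      fun _ hb _ ha => h.spanSnd_mul_mem ha hb)
    fun _ => hs.eq_top_of_spanSnd

/-- If the tensor factors of an associative double bracket span `End V`, then every subspace is
an ideal. -/
theorem IsDoubleAssoc.isDoubleIdeal (h : IsDoubleAssoc D) (hL : spanFst D = ⊤)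
    (hR : spanSnd D = ⊤) (I : Submodule K V) : IsDoubleIdeal D I := by
  obtain ⟨g, hg⟩ := I.subtype.exists_leftInverse_of_injective I.ker_subtype
  let p : Module.End K V := I.subtype ∘ₗ g
  have hp (v : V) : p v ∈ I := (g v).2
  have hpI (v : V) (hv : v ∈ I) : p v = v := congr(($hg ⟨v, hv⟩ : V))
  refine isDoubleIdeal_of_tmul_mem (fun v hv w => Submodule.mem_sup_right ?_)
    fun v w hw => Submodule.mem_sup_left ?_
  · have := lTensor_mem_sideR hp (D (v ⊗ₜ w))
    rwa [h.lTensor_comm (hR ▸ Submodule.mem_top), LinearMap.rTensor_tmul, hpI v hv] at this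
  · have := rTensor_mem_sideL hp (D (v ⊗ₜ w))
    rwa [h.rTensor_comm (hL ▸ Submodule.mem_top), LinearMap.lTensor_tmul, hpI w hw] at this

end DoubleBracket

/-- Corollary (algebraically closed case): a simple finite-dimensional associative double
algebra over an algebraically closed field is one-dimensional with double bracket
`⟦u,v⟧ = α·(u ⊗ v)` for some nonzero `α`. -/
theorem stmt14 {K V : Type*} [Field K] [IsAlgClosed K] [AddCommGroup V] [Module K V]
    [FiniteDimensional K V]
    (D : V ⊗[K] V →ₗ[K] V ⊗[K] V)
    (hassoc : IsDoubleAssoc D) (hsimple : IsSimpleDouble D) :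
    Module.finrank K V = 1 ∧ ∃ α : K, α ≠ 0 ∧ ∀ w : V ⊗[K] V, D w = α • w := by
  have : Nontrivial V := by
    by_contra hV
    rw [not_nontrivial_iff_subsingleton] at hV
    exact hsimple.1 (Subsingleton.elim _ _)
  obtain ⟨v, hv⟩ := exists_ne (0 : V)
  have hI := hassoc.isDoubleIdeal (hassoc.spanFst_eq_top hsimple) (hassoc.spanSnd_eq_top hsimple)
  have hone : Module.finrank K V = 1 :=
    (finrank_eq_one_iff_of_nonzero v hv).2 <|
      (hsimple.2 _ (hI (Submodule.span K {v}))).resolve_left (by simpa using hv)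
  have hEnd : Module.finrank K (Module.End K (V ⊗[K] V)) = 1 := by
    simp [Module.finrank_linearMap, hone]
  have hid : (LinearMap.id : Module.End K (V ⊗[K] V)) ≠ 0 := fun h0 =>
    hsimple.1 (by rw [← D.comp_id, h0, LinearMap.comp_zero])
  obtain ⟨α, hα⟩ := exists_smul_eq_of_finrank_eq_one hEnd hid D
  refine ⟨hone, α, ?_, fun w => by simp [← hα]⟩
  rintro rfl
  exact hsimple.1 (by rw [← hα, zero_smul])
end

section
/- Let K be a field and V a nonzero finite-dimensional K-vector space. Let B ⊆ End_K(V) be a K-subspace that contains the identity id_V, is closed under composition, and acts irreducibly on V (every subspace W ⊆ V with b(W) ⊆ W for all b ∈ B equals 0 or V). Let I ⊆ B be a K-subspace which is a right ideal of B (x ∘ b ∈ I for all x ∈ I, b ∈ B) with I ≠ B. Then the subspace of V spanned by {x(v) : x ∈ I, v ∈ V} is not equal to V. -/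
/-- If a `K`-algebra of endomorphisms of `V` makes the finite-dimensional space `V` semisimple,
then the algebra is a retract, as a left module over itself, of a finite power of `V`. -/
theorem Subalgebra.exists_pi_linearMap_leftInverse {K V : Type*} [Field K] [AddCommGroup V]
    [Module K V] [FiniteDimensional K V] (S : Subalgebra K (Module.End K V))
    [IsSemisimpleModule S V] :
    ∃ (f : S →ₗ[S] (Fin (Module.finrank K V) → V)) (g : (Fin (Module.finrank K V) → V) →ₗ[S] S),
      g ∘ₗ f = LinearMap.id := by
  let e := Module.finBasis K V
  let f : S →ₗ[S] (Fin (Module.finrank K V) → V) :=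
    LinearMap.pi fun i => LinearMap.toSpanSingleton S V (e i)
  have hf : Function.Injective f := by
    intro s t h
    refine Subtype.ext (e.ext fun i => ?_)
    exact congrFun h i
  obtain ⟨g, hg⟩ := IsSemisimpleModule.extension_property f hf LinearMap.id
  exact ⟨f, g, hg⟩

/-- Lemma 5: if `B` is an irreducible unital subalgebra of `End V` and `I` is a proper
right ideal of `B`, then `I·V ≠ V`. -/
theorem stmt15 {K V : Type*} [Field K] [AddCommGroup V] [Module K V]
    [FiniteDimensional K V] [Nontrivial V]
    (B : Submodule K (V →ₗ[K] V))
    (hid : LinearMap.id ∈ B)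
    (hmul : ∀ x ∈ B, ∀ y ∈ B, x ∘ₗ y ∈ B)
    (hirr : ∀ W : Submodule K V, (∀ b ∈ B, ∀ w ∈ W, b w ∈ W) → W = ⊥ ∨ W = ⊤)
    (I : Submodule K (V →ₗ[K] V)) (hIB : I ≤ B)
    (hright : ∀ x ∈ I, ∀ b ∈ B, x ∘ₗ b ∈ I) (hne : I ≠ B) :
    Submodule.span K {w : V | ∃ x ∈ I, ∃ v : V, x v = w} ≠ ⊤ := by
  intro htop
  let S : Subalgebra K (Module.End K V) :=
    B.toSubalgebra hid fun x y hx hy => hmul x hx y hy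
  have hsimple : IsSimpleModule S V := by
    rw [isSimpleModule_iff]
    refine { eq_bot_or_eq_top := fun W => ?_ }
    refine (hirr (W.restrictScalars K) fun b hb w hw => W.smul_mem (⟨b, hb⟩ : S) hw).imp ?_ ?_
    · exact fun h => (Submodule.restrictScalars_eq_bot_iff K S V).1 h
    · exact fun h => (Submodule.restrictScalars_eq_top_iff K S V).1 h
  obtain ⟨f, g, hgf⟩ := S.exists_pi_linearMap_leftInverse
  have hmem : ∀ i (v : V), (g (Pi.single i v) : Module.End K V) ∈ I := by
    intro i v
    have hv : v ∈ Submodule.span K {w : V | ∃ x ∈ I, ∃ v : V, x v = w} := htop ▸ trivial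
    let φ : V →ₗ[K] Module.End K V :=
      S.val.toLinearMap ∘ₗ (g ∘ₗ LinearMap.single S (fun _ => V) i).restrictScalars K
    refine (Submodule.span_le (p := I.comap φ)).2 ?_ hv
    rintro _ ⟨x, hx, v, rfl⟩
    have h : (g ∘ₗ LinearMap.single S (fun _ => V) i) ((⟨x, hIB hx⟩ : S) • v) =
        (⟨x, hIB hx⟩ : S) • (g ∘ₗ LinearMap.single S (fun _ => V) i) v := map_smul _ _ _
    have h' : φ (x v) = x ∘ₗ φ v := congrArg Subtype.val h
    change φ (x v) ∈ I
    rw [h']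
    exact hright x hx _ (g (Pi.single i v)).2
  have hone : LinearMap.id ∈ I := by
    have h1 : g (f 1) = 1 := LinearMap.congr_fun hgf 1
    rw [← Finset.univ_sum_single (f 1), map_sum] at h1
    have h2 : (∑ i, (g (Pi.single i (f 1 i)) : Module.End K V)) = 1 := by
      simpa using congrArg S.val h1
    change (1 : Module.End K V) ∈ I
    rw [← h2]
    exact I.sum_mem fun i _ => hmem i _
  exact hne (le_antisymm hIB fun b hb => hright _ hone b hb)
end

section
/- Let K be a field, V a K-vector space, and D : V ⊗[K] V → V ⊗[K] V a double bracket satisfying the double associativity identities. Then the double commutator bracket D' := D − τ∘D∘τ (corresponding to ⟦a,b⟧ = ⦃a,b⦄ − ⦃b,a⦄^{(12)}) satisfies the double Lie identities (anti-symmetry and double Jacobi). -/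
open TensorProduct

/-- The double Jacobi identity for the commutator bracket, in a ring containing a copy of `S₃`
generated by the involutions `a`, `b`; here `l` plays the role of `D ⊗ id` and `r` the role of
`id ⊗ D`. -/
theorem commutator_jacobi_of_assoc {A : Type*} [Ring A] {a b l r : A}
    (haa : a * a = 1) (hbb : b * b = 1) (hbab : b * (a * b) = a * (b * a))
    (hr : r = a * (b * (l * (b * a))))
    (h₁ : l * r = b * (l * (b * l))) (h₂ : a * (r * (a * r)) = r * l) :
    (l - a * (l * a)) * (r - b * (r * b)) -
        (r - b * (r * b)) * (a * ((r - b * (r * b)) * a)) =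
      b * ((l - a * (l * a)) * (b * (l - a * (l * a)))) := by
  subst hr
  have haa' (x : A) : a * (a * x) = x := by rw [← mul_assoc, haa, one_mul]
  have hbb' (x : A) : b * (b * x) = x := by rw [← mul_assoc, hbb, one_mul]
  have hbab' (x : A) : b * (a * (b * x)) = a * (b * (a * x)) := by
    simpa only [mul_assoc] using congrArg (· * x) hbab
  have conj {x y : A} (h : x = y) (u v : A) : u * (x * v) = u * (y * v) := by rw [h]
  have e₁ := conj h₁ (a * b) (b * a)
  have e₂ := conj h₂ b b
  have e₃ := conj h₂ (a * (b * a)) (a * (b * a))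
  have e₄ := conj h₂ a a
  have e₅ := conj h₁ (b * a) (a * b)
  simp only [mul_assoc, mul_sub, sub_mul, haa, haa', hbb, hbb', hbab, hbab', mul_one] at *
  grind

theorem flipT_comp_flipT (K X : Type*) [Field K] [AddCommGroup X] [Module K X] :
    flipT K X ∘ₗ flipT K X = LinearMap.id := by
  ext x y
  simp [flipT]

theorem dL_sub_flip {K X : Type*} [Field K] [AddCommGroup X] [Module K X]
    (D : X ⊗[K] X →ₗ[K] X ⊗[K] X) :
    dL (D - flipT K X ∘ₗ D ∘ₗ flipT K X) = dL D - t12 K X ∘ₗ dL D ∘ₗ t12 K X := by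
  ext x y z
  simp [dL, t12, TensorProduct.sub_tmul]

theorem dR_sub_flip {K X : Type*} [Field K] [AddCommGroup X] [Module K X]
    (D : X ⊗[K] X →ₗ[K] X ⊗[K] X) :
    dR (D - flipT K X ∘ₗ D ∘ₗ flipT K X) = dR D - t23 K X ∘ₗ dR D ∘ₗ t23 K X := by
  ext x y z
  simp [dR, t23, TensorProduct.tmul_sub]

theorem t12_comp_t12 (K X : Type*) [Field K] [AddCommGroup X] [Module K X] :
    t12 K X ∘ₗ t12 K X = LinearMap.id := by
  ext x y z
  simp [t12, flipT]

theorem t23_comp_t23 (K X : Type*) [Field K] [AddCommGroup X] [Module K X] :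
    t23 K X ∘ₗ t23 K X = LinearMap.id := by
  ext x y z
  simp [t23, flipT]

theorem t23_comp_t12_comp_t23 (K X : Type*) [Field K] [AddCommGroup X] [Module K X] :
    t23 K X ∘ₗ t12 K X ∘ₗ t23 K X = t12 K X ∘ₗ t23 K X ∘ₗ t12 K X := by
  ext x y z
  simp [t12, t23, flipT]

/-- `id ⊗ D` is the conjugate of `D ⊗ id` by a cyclic permutation of the tensor factors. -/
theorem dR_eq_conj_dL {K X : Type*} [Field K] [AddCommGroup X] [Module K X]
    (D : X ⊗[K] X →ₗ[K] X ⊗[K] X) :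
    dR D = t12 K X ∘ₗ t23 K X ∘ₗ dL D ∘ₗ t23 K X ∘ₗ t12 K X := by
  have key (x : X) (w : X ⊗[K] X) :
      t12 K X (t23 K X (w ⊗ₜ[K] x)) = (TensorProduct.assoc K X X X).symm (x ⊗ₜ[K] w) := by
    induction w with
    | zero => simp
    | tmul u v => simp [t12, t23, flipT]
    | add u v hu hv => simp only [TensorProduct.add_tmul, TensorProduct.tmul_add, map_add, hu, hv]
  ext x y z
  have hperm : t23 K X (t12 K X (x ⊗ₜ[K] y ⊗ₜ[K] z)) = y ⊗ₜ[K] z ⊗ₜ[K] x := by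
    simp [t12, t23, flipT]
  simp [hperm, dL, key, dR]

/-- Lemma 1: the double commutator bracket `D' = D - τ∘D∘τ` of an associative double
bracket `D` satisfies the double Lie identities. -/
theorem stmt17 {K V : Type*} [Field K] [AddCommGroup V] [Module K V]
    (D : V ⊗[K] V →ₗ[K] V ⊗[K] V)
    (hassoc : IsDoubleAssoc D) :
    IsDoubleLie (D - flipT K V ∘ₗ D ∘ₗ flipT K V) := by
  obtain ⟨h₁, h₂⟩ := hassoc
  refine ⟨?_, ?_⟩
  · have hf (x : V ⊗[K] V) : flipT K V (flipT K V x) = x :=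
      LinearMap.congr_fun (flipT_comp_flipT K V) x
    refine LinearMap.ext fun x => ?_
    simp [hf]
  · rw [dL_sub_flip, dR_sub_flip]
    exact commutator_jacobi_of_assoc (A := Module.End K ((V ⊗[K] V) ⊗[K] V))
      (t12_comp_t12 K V) (t23_comp_t23 K V) (t23_comp_t12_comp_t23 K V)
      (dR_eq_conj_dL D) h₁ h₂
end

section
/- Let K be a field, V and U K-vector spaces, D_V a double bracket on V satisfying the double associativity identities, and D_U a double bracket on U satisfying the double associativity identities together with the double commutativity τ_U∘D_U∘τ_U = D_U. Then the induced double bracket D on W = V ⊗[K] U, defined by D = P ∘ (D_V ⊗ D_U) ∘ P⁻¹ where P : (V⊗V)⊗(U⊗U) → (V⊗U)⊗(V⊗U) is the canonical middle-swap isomorphism, satisfies the double associativity identities. -/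
open TensorProduct

/-- The induced double bracket on `V ⊗ U` built from double brackets on `V` and `U` via
the canonical middle-swap isomorphism `(V⊗V)⊗(U⊗U) ≃ (V⊗U)⊗(V⊗U)`. -/
noncomputable def inducedBracket {K V U : Type*} [Field K]
    [AddCommGroup V] [Module K V] [AddCommGroup U] [Module K U]
    (DV : V ⊗[K] V →ₗ[K] V ⊗[K] V) (DU : U ⊗[K] U →ₗ[K] U ⊗[K] U) :
    (V ⊗[K] U) ⊗[K] (V ⊗[K] U) →ₗ[K] (V ⊗[K] U) ⊗[K] (V ⊗[K] U) :=
  (TensorProduct.tensorTensorTensorComm K V V U U).toLinearMap ∘ₗ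
    TensorProduct.map DV DU ∘ₗ
      (TensorProduct.tensorTensorTensorComm K V V U U).symm.toLinearMap

section InducedBracket

variable {K V U : Type*} [Field K] [AddCommGroup V] [Module K V] [AddCommGroup U] [Module K U]

variable (K V U) in
/-- The canonical shuffle `V^{⊗3} ⊗ U^{⊗3} ≃ (V ⊗ U)^{⊗3}`. -/
noncomputable def shuffle₃ :
    ((V ⊗[K] V) ⊗[K] V) ⊗[K] ((U ⊗[K] U) ⊗[K] U) ≃ₗ[K]
      ((V ⊗[K] U) ⊗[K] (V ⊗[K] U)) ⊗[K] (V ⊗[K] U) :=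
  TensorProduct.tensorTensorTensorComm K (V ⊗[K] V) V (U ⊗[K] U) U ≪≫ₗ
    TensorProduct.congr (TensorProduct.tensorTensorTensorComm K V V U U) (.refl K _)

@[simp]
theorem shuffle₃_tmul_tmul (x : V ⊗[K] V) (v : V) (y : U ⊗[K] U) (u : U) :
    shuffle₃ K V U ((x ⊗ₜ v) ⊗ₜ (y ⊗ₜ u)) =
      TensorProduct.tensorTensorTensorComm K V V U U (x ⊗ₜ y) ⊗ₜ (v ⊗ₜ u) := by
  simp [shuffle₃]

theorem shuffle₃_assoc_symm (v : V) (x : V ⊗[K] V) (u : U) (y : U ⊗[K] U) :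
    shuffle₃ K V U ((TensorProduct.assoc K V V V).symm (v ⊗ₜ x) ⊗ₜ
        (TensorProduct.assoc K U U U).symm (u ⊗ₜ y)) =
      (TensorProduct.assoc K _ _ _).symm
        ((v ⊗ₜ u) ⊗ₜ TensorProduct.tensorTensorTensorComm K V V U U (x ⊗ₜ y)) := by
  induction x with
  | zero => simp
  | add x x' hx hx' => simp only [TensorProduct.tmul_add, TensorProduct.add_tmul, map_add, hx, hx']
  | tmul a b =>
    induction y with
    | zero => simp
    | add y y' hy hy' => simp only [TensorProduct.tmul_add, map_add, hy, hy']
    | tmul c d => simp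

theorem dL_inducedBracket (DV : V ⊗[K] V →ₗ[K] V ⊗[K] V) (DU : U ⊗[K] U →ₗ[K] U ⊗[K] U) :
    dL (inducedBracket DV DU) ∘ₗ (shuffle₃ K V U).toLinearMap =
      (shuffle₃ K V U).toLinearMap ∘ₗ TensorProduct.map (dL DV) (dL DU) := by
  ext
  simp [dL, inducedBracket]

theorem dR_inducedBracket (DV : V ⊗[K] V →ₗ[K] V ⊗[K] V) (DU : U ⊗[K] U →ₗ[K] U ⊗[K] U) :
    dR (inducedBracket DV DU) ∘ₗ (shuffle₃ K V U).toLinearMap =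
      (shuffle₃ K V U).toLinearMap ∘ₗ TensorProduct.map (dR DV) (dR DU) := by
  ext
  simp [dR, inducedBracket, shuffle₃_assoc_symm]

variable (K V U) in
theorem flipT_tensor :
    flipT K (V ⊗[K] U) = inducedBracket (flipT K V) (flipT K U) := by
  ext
  simp [flipT, inducedBracket]

variable (K V U) in
theorem t12_shuffle₃ :
    t12 K (V ⊗[K] U) ∘ₗ (shuffle₃ K V U).toLinearMap =
      (shuffle₃ K V U).toLinearMap ∘ₗ TensorProduct.map (t12 K V) (t12 K U) := by
  rw [t12, flipT_tensor]
  exact dL_inducedBracket _ _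

variable (K V U) in
theorem t23_shuffle₃ :
    t23 K (V ⊗[K] U) ∘ₗ (shuffle₃ K V U).toLinearMap =
      (shuffle₃ K V U).toLinearMap ∘ₗ TensorProduct.map (t23 K V) (t23 K U) := by
  rw [t23, flipT_tensor]
  exact dR_inducedBracket _ _

/-- Double associativity passes to the induced bracket; commutativity is not needed. -/
theorem IsDoubleAssoc.inducedBracket {DV : V ⊗[K] V →ₗ[K] V ⊗[K] V}
    {DU : U ⊗[K] U →ₗ[K] U ⊗[K] U} (hV : IsDoubleAssoc DV) (hU : IsDoubleAssoc DU) :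
    IsDoubleAssoc (inducedBracket DV DU) := by
  have hL := LinearMap.congr_fun (dL_inducedBracket DV DU)
  have hR := LinearMap.congr_fun (dR_inducedBracket DV DU)
  have h12 := LinearMap.congr_fun (t12_shuffle₃ K V U)
  have h23 := LinearMap.congr_fun (t23_shuffle₃ K V U)
  simp only [LinearMap.comp_apply, LinearEquiv.coe_coe] at hL hR h12 h23
  constructor
  · refine LinearMap.ext fun w => ?_
    obtain ⟨z, rfl⟩ := (shuffle₃ K V U).surjective w
    simp only [LinearMap.comp_apply, hL, hR, h23]
    simp only [← LinearMap.comp_apply, ← TensorProduct.map_comp, hV.1, hU.1]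
  · refine LinearMap.ext fun w => ?_
    obtain ⟨z, rfl⟩ := (shuffle₃ K V U).surjective w
    simp only [LinearMap.comp_apply, hL, hR, h12]
    simp only [← LinearMap.comp_apply, ← TensorProduct.map_comp, hV.2, hU.2]

end InducedBracket

/-- If `V` is an associative double algebra and `U` is a commutative associative double
algebra, then `V ⊗ U` with the induced double bracket is an associative double algebra. -/
theorem stmt19 {K V U : Type*} [Field K]
    [AddCommGroup V] [Module K V] [AddCommGroup U] [Module K U]
    (DV : V ⊗[K] V →ₗ[K] V ⊗[K] V) (DU : U ⊗[K] U →ₗ[K] U ⊗[K] U)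
    (hV : IsDoubleAssoc DV)
    (hU : IsDoubleAssoc DU) (hUc : flipT K U ∘ₗ DU ∘ₗ flipT K U = DU) :
    IsDoubleAssoc (inducedBracket DV DU) := by
  exact hV.inducedBracket hU
end
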